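/- arXiv:1111.0582 — 5 statements merged into one kernel-verified Lean document; each statement's English description precedes it below -/
import Mathlib

section
/- Let F be a field of characteristic zero, n ≥ 1, χ : S_n → F^× a group homomorphism, and Imm_n = Σ_{σ ∈ S_n} χ(σ) ∏_{i=1}^{n} x_{i,σ(i)} ∈ F[x_{ij}]. Suppose Imm_n = C(f_1, …, f_m) for some polynomial C ∈ F[y_1, …, y_m] and polynomials f_1, …, f_m ∈ F[x_{ij}] each of sparsity at most s, with trdeg_F{f_1, …, f_m} ≤ r and r < n. Then (r+1)! · s^r ≥ 2^{n/2 − r − 1}. -/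
open MvPolynomial

/-- `trdegFam F f` : the maximal cardinality of a subset of the finite family `f`
that is algebraically independent over `F`. -/
noncomputable def trdegFam (F : Type*) {A : Type*} [CommRing F] [CommRing A] [Algebra F A]
    {m : ℕ} (f : Fin m → A) : ℕ :=
  sSup {k : ℕ | ∃ S : Finset (Fin m), S.card = k ∧
    AlgebraicIndependent F (fun i : {x // x ∈ S} => f i)}


section Comp
variable {V F : Type*} [DecidableEq V] [Field F]

/-- the part of `g` of degree exactly `e` in the variable `v` -/
noncomputable def vcomp (v : V) (e : ℕ) : MvPolynomial V F →ₗ[F] MvPolynomial V F :=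
  weightedHomogeneousComponent (Pi.single v 1 : V → ℕ) e

theorem coeff_vcomp (v : V) (e : ℕ) (g : MvPolynomial V F) (m : V →₀ ℕ) :
    coeff m (vcomp v e g) = if m v = e then coeff m g else 0 := by
  classical
  unfold vcomp
  rw [coeff_weightedHomogeneousComponent, Finsupp.weight_single_one_apply]

theorem vcomp_mul_X_self (v : V) (e : ℕ) (g : MvPolynomial V F) :
    vcomp v (e + 1) (g * X v) = vcomp v e g * X v := by
  ext m
  rw [coeff_vcomp, coeff_mul_X', coeff_mul_X', coeff_vcomp]
  by_cases h : v ∈ m.support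
  · have : m v ≠ 0 := by simpa using h
    simp only [h, if_true, Finsupp.tsub_apply, Finsupp.single_eq_same]
    congr 1
    apply propext; omega
  · simp [h]

theorem vcomp_zero_mul_X_self (v : V) (g : MvPolynomial V F) :
    vcomp v 0 (g * X v) = 0 := by
  ext m
  rw [coeff_vcomp, coeff_mul_X']
  by_cases h : v ∈ m.support
  · have : m v ≠ 0 := by simpa using h
    simp [this]
  · simp [h]

/-- `B` does not involve the variable `v`. -/
def NoVar (v : V) (B : MvPolynomial V F) : Prop :=
  ∀ e g, vcomp v e (g * B) = vcomp v e g * B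

theorem noVar_X {v w : V} (h : w ≠ v) : NoVar v (X w : MvPolynomial V F) := by
  intro e g
  ext m
  rw [coeff_vcomp, coeff_mul_X', coeff_mul_X', coeff_vcomp]
  by_cases hm : w ∈ m.support
  · simp [hm, h]
  · simp [hm]

theorem noVar_C (v : V) (a : F) : NoVar v (C a : MvPolynomial V F) := by
  intro e g
  rw [mul_comm, ← smul_eq_C_mul, map_smul, mul_comm, ← smul_eq_C_mul]

theorem NoVar.mul {v : V} {A B : MvPolynomial V F} (hA : NoVar v A) (hB : NoVar v B) :
    NoVar v (A * B) := by
  intro e g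
  rw [← mul_assoc, hB, hA, mul_assoc]

theorem noVar_prod {v : V} {s : Finset V} (h : v ∉ s) :
    NoVar v (∏ c ∈ s, X c : MvPolynomial V F) := by
  induction s using Finset.induction_on with
  | empty => intro e g; simp
  | insert a s ha ih =>
    rw [Finset.prod_insert ha]
    simp only [Finset.mem_insert, not_or] at h
    exact (noVar_X (Ne.symm h.1)).mul (ih h.2)

theorem noVar_sum {ι : Type*} {v : V} {s : Finset ι} {B : ι → MvPolynomial V F}
    (h : ∀ i ∈ s, NoVar v (B i)) : NoVar v (∑ i ∈ s, B i) := by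
  intro e g
  rw [Finset.mul_sum, map_sum, Finset.mul_sum]
  exact Finset.sum_congr rfl fun i hi => h i hi e g

theorem support_vcomp (v : V) (e : ℕ) (g : MvPolynomial V F) :
    (vcomp v e g).support = g.support.filter (fun m => m v = e) := by
  ext m
  simp only [mem_support_iff, coeff_vcomp, Finset.mem_filter]
  split_ifs with h <;> simp [h]

theorem card_vcomp_le (v : V) (e : ℕ) (g : MvPolynomial V F) :
    (vcomp v e g).support.card ≤ g.support.card := by
  rw [support_vcomp]; exact Finset.card_filter_le _ _

theorem card_vcomp_add_le (v : V) {e e' : ℕ} (h : e ≠ e') (g : MvPolynomial V F) :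
    (vcomp v e g).support.card + (vcomp v e' g).support.card ≤ g.support.card := by
  rw [support_vcomp, support_vcomp, ← Finset.card_union_of_disjoint]
  · apply Finset.card_le_card
    intro m; simp only [Finset.mem_union, Finset.mem_filter]; tauto
  · rw [Finset.disjoint_filter]; intro m _ h1 h2; exact h (h1.symm.trans h2)

theorem vcomp_eq_self {v : V} {e : ℕ} {g : MvPolynomial V F} (h : ∀ m ∈ g.support, m v = e) :
    vcomp v e g = g := by
  ext m
  rw [coeff_vcomp]
  split_ifs with h1
  · rfl
  · by_contra h2
    exact h1 (h m (mem_support_iff.2 (Ne.symm h2)))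

theorem vcomp_eq_zero {v : V} {e : ℕ} {g : MvPolynomial V F} (h : ∀ m ∈ g.support, m v ≠ e) :
    vcomp v e g = 0 := by
  ext m
  rw [coeff_vcomp]
  split_ifs with h1
  · by_contra h2
    exact h m (mem_support_iff.2 h2) h1
  · simp

theorem vcomp_ne_zero {v : V} {g : MvPolynomial V F} {m : V →₀ ℕ} (h : m ∈ g.support) :
    vcomp v (m v) g ≠ 0 := by
  intro h0
  have := coeff_vcomp v (m v) g m
  rw [h0, if_pos rfl] at this
  exact (mem_support_iff.1 h) (by simpa using this.symm)

/-- extremal degrees -/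
theorem exists_extr {T : Finset V} {g : V → MvPolynomial V F} (hg : ∃ c ∈ T, g c ≠ 0) (v : V) :
    ∃ lo hi : ℕ, lo ≤ hi ∧ (∀ c ∈ T, ∀ m ∈ (g c).support, lo ≤ m v ∧ m v ≤ hi) ∧
      (∃ c ∈ T, vcomp v lo (g c) ≠ 0) ∧ (∃ c ∈ T, vcomp v hi (g c) ≠ 0) := by
  classical
  let A : Finset ℕ := T.biUnion fun c => (g c).support.image fun m => m v
  have hA : A.Nonempty := by
    obtain ⟨c, hc, h0⟩ := hg
    obtain ⟨m, hm⟩ := Finset.nonempty_iff_ne_empty.2 (fun h => h0 (support_eq_empty.1 h))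
    exact ⟨m v, Finset.mem_biUnion.2 ⟨c, hc, Finset.mem_image_of_mem _ hm⟩⟩
  have key : ∀ e ∈ A, ∃ c ∈ T, vcomp v e (g c) ≠ 0 := by
    intro e he
    simp only [A, Finset.mem_biUnion, Finset.mem_image] at he
    obtain ⟨c, hc, m, hm, rfl⟩ := he
    exact ⟨c, hc, vcomp_ne_zero hm⟩
  refine ⟨A.min' hA, A.max' hA, Finset.min'_le _ _ (Finset.max'_mem _ _), ?_,
    key _ (Finset.min'_mem _ _), key _ (Finset.max'_mem _ _)⟩
  intro c hc m hm
  have : m v ∈ A := Finset.mem_biUnion.2 ⟨c, hc, Finset.mem_image_of_mem _ hm⟩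
  exact ⟨Finset.min'_le _ _ this, Finset.le_max' _ _ this⟩

/-- top step -/
theorem top_step {T L : Finset V} {g : V → MvPolynomial V F} {B : V → V → MvPolynomial V F}
    {v : V} (hv : v ∈ L) (hB : ∀ c ∈ T, ∀ w ∈ L, NoVar v (B c w)) {hi : ℕ}
    (hhi : ∀ c ∈ T, ∀ m ∈ (g c).support, m v ≤ hi)
    (hrel : ∑ w ∈ L, ∑ c ∈ T, g c * X w * B c w = 0) :
    ∑ c ∈ T, vcomp v hi (g c) * B c v = 0 := by
  have h := congrArg (vcomp v (hi + 1)) hrel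
  rw [map_sum, Finset.sum_eq_single_of_mem v hv, map_sum, map_zero] at h
  · have h2 : (∑ c ∈ T, vcomp v hi (g c) * B c v) * X v = 0 := by
      rw [← h, Finset.sum_mul]
      refine Finset.sum_congr rfl fun c hc => ?_
      rw [hB c hc v hv, vcomp_mul_X_self]; ring
    exact (mul_eq_zero.1 h2).resolve_right (X_ne_zero v)
  · intro w hw hwv
    rw [map_sum]
    refine Finset.sum_eq_zero fun c hc => ?_
    rw [hB c hc w hw, noVar_X hwv, vcomp_eq_zero, zero_mul, zero_mul]
    intro m hm h'
    have := hhi c hc m hm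
    omega

/-- low step -/
theorem low_step {T L : Finset V} {g : V → MvPolynomial V F} {B : V → V → MvPolynomial V F}
    {v : V} (hv : v ∈ L) (hB : ∀ c ∈ T, ∀ w ∈ L, NoVar v (B c w)) {lo : ℕ}
    (hlo : ∀ c ∈ T, ∀ m ∈ (g c).support, lo ≤ m v)
    (hrel : ∑ w ∈ L, ∑ c ∈ T, g c * X w * B c w = 0) :
    ∑ w ∈ L.erase v, ∑ c ∈ T, vcomp v lo (g c) * X w * B c w = 0 := by
  have h := congrArg (vcomp v lo) hrel
  rw [map_sum, ← Finset.add_sum_erase _ _ hv, map_zero] at h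
  rw [← h]
  have h0 : vcomp v lo (∑ c ∈ T, g c * X v * B c v) = 0 := by
    rw [map_sum]
    refine Finset.sum_eq_zero fun c hc => ?_
    rw [hB c hc v hv]
    cases lo with
    | zero => rw [vcomp_zero_mul_X_self, zero_mul]
    | succ k =>
      rw [vcomp_mul_X_self, vcomp_eq_zero, zero_mul, zero_mul]
      intro m hm h'
      have := hlo c hc m hm
      omega
  rw [h0, zero_add]
  refine Finset.sum_congr rfl fun w hw => ?_
  rw [map_sum]
  refine Finset.sum_congr rfl fun c hc => ?_
  rw [hB c hc w (Finset.mem_of_mem_erase hw), noVar_X (Finset.ne_of_mem_erase hw)]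

end Comp

/-- Abstract system of permutation graphs with coefficients. -/
structure Sys (V I P F : Type*) [DecidableEq V] [Field F] where
  p : V → I
  q : V → I
  gr : P → Finset V
  a : P → F
  ha : ∀ σ, a σ ≠ 0
  inj : Function.Injective gr
  pinj : ∀ σ, Set.InjOn p (gr σ)
  qinj : ∀ σ, Set.InjOn q (gr σ)
  psurj : ∀ σ i, ∃ v ∈ gr σ, p v = i
  qsurj : ∀ σ i, ∃ v ∈ gr σ, q v = i
  ext : ∀ E : Finset V, Set.InjOn p E → Set.InjOn q E → ∃ σ, E ⊆ gr σ
  cell : ∀ i j, ∃ v, p v = i ∧ q v = j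
  uniq : ∀ v w, p v = p w → q v = q w → v = w

namespace Sys
set_option linter.unusedSectionVars false
variable {V I P F : Type*} [DecidableEq V] [Field F] [Fintype P] [Fintype V]
  [Fintype I] [DecidableEq I]

/-- exchange rows and columns -/
def swap (A : Sys V I P F) : Sys V I P F where
  p := A.q
  q := A.p
  gr := A.gr
  a := A.a
  ha := A.ha
  inj := A.inj
  pinj := A.qinj
  qinj := A.pinj
  psurj := A.qsurj
  qsurj := A.psurj
  ext := fun E h1 h2 => A.ext E h2 h1
  cell := fun i j => by obtain ⟨v, h1, h2⟩ := A.cell j i; exact ⟨v, h2, h1⟩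
  uniq := fun v w h1 h2 => A.uniq v w h2 h1

/-- the minor of the immanant -/
noncomputable def imm (A : Sys V I P F) (E : Finset V) : MvPolynomial V F :=
  ∑ σ : P with E ⊆ A.gr σ, C (A.a σ) * ∏ c ∈ A.gr σ \ E, X c

theorem imm_swap (A : Sys V I P F) (E : Finset V) : A.swap.imm E = A.imm E := rfl

theorem imm_ne_zero (A : Sys V I P F) {E : Finset V} (hp : Set.InjOn A.p E)
    (hq : Set.InjOn A.q E) : A.imm E ≠ 0 := by
  classical
  obtain ⟨σ, hσ⟩ := A.ext E hp hq
  have hmon : ∀ S : Finset V, (∏ c ∈ S, X c : MvPolynomial V F)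
      = monomial (∑ c ∈ S, Finsupp.single c 1) 1 := by
    intro S
    rw [monomial_sum_one]; rfl
  have hap : ∀ (S : Finset V) (v : V), (∑ c ∈ S, Finsupp.single c 1 : V →₀ ℕ) v
      = if v ∈ S then 1 else 0 := by
    intro S v
    simp [Finsupp.finsetSum_apply, Finsupp.single_apply]
  intro h0
  have h := congrArg (coeff (∑ c ∈ A.gr σ \ E, Finsupp.single c 1)) h0
  unfold imm at h
  rw [coeff_sum, Finset.sum_eq_single_of_mem σ (by simpa using hσ)] at h
  · rw [hmon, coeff_C_mul, coeff_monomial, if_pos rfl] at h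
    exact A.ha σ (by simpa using h)
  · intro τ hτ hne
    rw [hmon, coeff_C_mul, coeff_monomial, if_neg, mul_zero]
    intro he
    apply hne
    apply A.inj
    have hτ' : E ⊆ A.gr τ := by simpa using hτ
    ext v
    have h1 := hap (A.gr τ \ E) v
    rw [he, hap] at h1
    by_cases hv : v ∈ E
    · simp [hτ' hv, hσ hv]
    · simp only [Finset.mem_sdiff, hv, not_false_eq_true, and_true] at h1
      split_ifs at h1 <;> simp_all

theorem imm_eq_zero (A : Sys V I P F) {E : Finset V} {v w : V} (hv : v ∈ E) (hw : w ∈ E)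
    (hvw : v ≠ w) (hq : A.q v = A.q w) : A.imm E = 0 := by
  unfold imm
  rw [Finset.filter_eq_empty_iff.2, Finset.sum_empty]
  intro σ _ hE
  exact hvw (A.qinj σ (hE hv) (hE hw) hq)

theorem noVar_imm (A : Sys V I P F) {E : Finset V} {v w : V} (hv : v ∈ E)
    (hp : A.p v = A.p w) : NoVar w (A.imm E) := by
  refine noVar_sum fun σ hσ => (noVar_C _ _).mul (noVar_prod ?_)
  have hE : E ⊆ A.gr σ := by simpa using hσ
  intro hw
  rw [Finset.mem_sdiff] at hw
  have := A.pinj σ (hE hv) hw.1 hp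
  exact hw.2 (this ▸ hv)

theorem imm_expand (A : Sys V I P F) {E : Finset V} {i : I} (hi : ∀ e ∈ E, A.p e ≠ i) :
    A.imm E = ∑ v : V with A.p v = i, X v * A.imm (insert v E) := by
  classical
  unfold imm
  have hR : (∑ v : V with A.p v = i, X v * ∑ σ : P with insert v E ⊆ A.gr σ,
        C (A.a σ) * ∏ c ∈ A.gr σ \ insert v E, X c : MvPolynomial V F) =
      ∑ v : V with A.p v = i, ∑ σ : P, if insert v E ⊆ A.gr σ then
        X v * (C (A.a σ) * ∏ c ∈ A.gr σ \ insert v E, X c) else 0 := by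
    refine Finset.sum_congr rfl fun v _ => ?_
    rw [Finset.mul_sum, Finset.sum_filter]
  rw [hR, Finset.sum_comm, Finset.sum_filter]
  refine Finset.sum_congr rfl fun σ _ => ?_
  split_ifs with hE
  · obtain ⟨v, hv, hpv⟩ := A.psurj σ i
    rw [Finset.sum_eq_single_of_mem v (by simpa using hpv)]
    · have hvE : v ∉ E := fun h => hi v h hpv
      rw [if_pos (Finset.insert_subset hv hE)]
      rw [← Finset.mul_prod_erase (A.gr σ \ E) _ (Finset.mem_sdiff.2 ⟨hv, hvE⟩)]
      rw [show (A.gr σ \ E).erase v = A.gr σ \ insert v E by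
        ext x; simp only [Finset.mem_erase, Finset.mem_sdiff, Finset.mem_insert]; tauto]
      ring
    · intro w hw hwv
      rw [if_neg]
      intro h
      apply hwv
      exact A.pinj σ (h (Finset.mem_insert_self _ _)) hv
        (by rw [hpv]; simpa using hw)
  · symm
    refine Finset.sum_eq_zero fun v _ => if_neg fun h => hE ((Finset.subset_insert _ _).trans h)

/-- partial matching and transversality hypotheses, plus a nontrivial relation -/
structure Rel (A : Sys V I P F) (D T : Finset V) (g : V → MvPolynomial V F) : Prop where
  dp : Set.InjOn A.p D
  dq : Set.InjOn A.q D
  tp : ∀ c ∈ T, ∀ d ∈ D, A.p c ≠ A.p d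
  tq : ∀ c ∈ T, ∀ d ∈ D, A.q c ≠ A.q d
  nz : ∃ c ∈ T, g c ≠ 0
  rel : ∑ c ∈ T, g c * A.imm (insert c D) = 0

/-- total sparsity -/
noncomputable def tot (T : Finset V) (g : V → MvPolynomial V F) : ℕ :=
  ∑ c ∈ T, (g c).support.card

theorem Rel.swap {A : Sys V I P F} {D T : Finset V} {g : V → MvPolynomial V F}
    (h : A.Rel D T g) : A.swap.Rel D T g :=
  ⟨h.dq, h.dp, h.tq, h.tp, h.nz, h.rel⟩

theorem tot_pos {T : Finset V} {g : V → MvPolynomial V F} (h : ∃ c ∈ T, g c ≠ 0) :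
    1 ≤ tot T g := by
  obtain ⟨c, hc, h0⟩ := h
  unfold tot
  have h1 : 1 ≤ (g c).support.card :=
    Finset.card_pos.2 (Finset.nonempty_iff_ne_empty.2 fun h => h0 (support_eq_empty.1 h))
  exact h1.trans (Finset.single_le_sum (f := fun c => (g c).support.card) (fun _ _ => Nat.zero_le _) hc)

theorem exists_free (p : V → I) (S : Finset V) (h : S.card < Fintype.card I) :
    ∃ i, ∀ c ∈ S, p c ≠ i := by
  by_contra hcon
  push Not at hcon
  have : (Finset.univ : Finset I) ⊆ S.image p := by
    intro i _
    obtain ⟨c, hc, h⟩ := hcon i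
    exact Finset.mem_image.2 ⟨c, hc, h⟩
  have := (Finset.card_le_card this).trans Finset.card_image_le
  rw [Finset.card_univ] at this
  omega

/-- adding a free cell to `D`. -/
theorem Rel.extend {A : Sys V I P F} {D T T' : Finset V} {g g' : V → MvPolynomial V F}
    (h : A.Rel D T g) {v : V} (hT : T' ⊆ T) (hp : ∀ c ∈ T, A.p c ≠ A.p v)
    (hpD : ∀ c ∈ D, A.p c ≠ A.p v) (hq : ∀ c ∈ T', A.q c ≠ A.q v)
    (hqD : ∀ c ∈ D, A.q c ≠ A.q v) (hnz : ∃ c ∈ T', g' c ≠ 0)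
    (hrel : ∑ c ∈ T', g' c * A.imm (insert v (insert c D)) = 0) :
    A.Rel (insert v D) T' g' := by
  refine ⟨?_, ?_, ?_, ?_, hnz, ?_⟩
  · rw [Finset.coe_insert, Set.injOn_insert]
    · refine ⟨h.dp, ?_⟩
      rintro ⟨d, hd, he⟩
      exact hpD d hd he
    · intro hv; exact hpD v hv rfl
  · rw [Finset.coe_insert, Set.injOn_insert]
    · refine ⟨h.dq, ?_⟩
      rintro ⟨d, hd, he⟩
      exact hqD d hd he
    · intro hv; exact hpD v hv rfl
  · intro c hc d hd
    rcases Finset.mem_insert.1 hd with rfl | hd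
    · exact hp c (hT hc)
    · exact h.tp c (hT hc) d hd
  · intro c hc d hd
    rcases Finset.mem_insert.1 hd with rfl | hd
    · exact hq c hc
    · exact h.tq c (hT hc) d hd
  · rw [← hrel]
    refine Finset.sum_congr rfl fun c _ => ?_
    rw [Finset.insert_comm]

/-- the row step -/
theorem row_step {A : Sys V I P F} {D T : Finset V} {g : V → MvPolynomial V F}
    (h : A.Rel D T g) (hcard : D.card + T.card + 1 < Fintype.card I)
    {c₁ c₂ : V} (hc₁ : c₁ ∈ T) (hc₂ : c₂ ∈ T) (hgc₂ : g c₂ ≠ 0) (hne : A.q c₁ ≠ A.q c₂) :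
    ∃ v T' g', A.Rel (insert v D) T' g' ∧ v ∉ D ∧
      ((T'.card ≤ T.card ∧ 2 * tot T' g' ≤ tot T g) ∨
       (T'.card + 1 ≤ T.card ∧ tot T' g' ≤ tot T g)) := by
  obtain ⟨i, hi⟩ := exists_free A.p (D ∪ T)
    ((Finset.card_union_le D T).trans_lt (by omega))
  obtain ⟨j, hj⟩ := exists_free A.q (D ∪ T)
    ((Finset.card_union_le D T).trans_lt (by omega))
  obtain ⟨v, hvi, hvj⟩ := A.cell i j
  obtain ⟨j', hj'⟩ := exists_free A.q (insert v (D ∪ T))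
    ((Finset.card_insert_le _ _).trans_lt (by have := Finset.card_union_le D T; omega))
  obtain ⟨v', hvi', hvj'⟩ := A.cell i j'
  obtain ⟨v₁, hvi₁, hvj₁⟩ := A.cell i (A.q c₁)
  have hpT : ∀ w, A.p w = i → ∀ c ∈ T, A.p c ≠ A.p w := fun w hw c hc => by
    rw [hw]; exact hi c (Finset.mem_union_right _ hc)
  have hpD : ∀ w, A.p w = i → ∀ c ∈ D, A.p c ≠ A.p w := fun w hw c hc => by
    rw [hw]; exact hi c (Finset.mem_union_left _ hc)
  have hqT : ∀ c ∈ T, A.q c ≠ A.q v := fun c hc => by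
    rw [hvj]; exact hj c (Finset.mem_union_right _ hc)
  have hqD : ∀ c ∈ D, A.q c ≠ A.q v := fun c hc => by
    rw [hvj]; exact hj c (Finset.mem_union_left _ hc)
  have hqT' : ∀ c ∈ T, A.q c ≠ A.q v' := fun c hc => by
    rw [hvj']; exact hj' c (Finset.mem_insert_of_mem (Finset.mem_union_right _ hc))
  have hqD' : ∀ c ∈ D, A.q c ≠ A.q v' := fun c hc => by
    rw [hvj']; exact hj' c (Finset.mem_insert_of_mem (Finset.mem_union_left _ hc))
  have hqD₁ : ∀ c ∈ D, A.q c ≠ A.q v₁ := fun c hc => by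
    rw [hvj₁]; exact (h.tq c₁ hc₁ c hc).symm
  have hvD : ∀ w, A.p w = i → w ∉ D := fun w hw hD => hpD w hw w hD rfl
  have hvv' : v' ≠ v := by
    rintro rfl
    exact hj' v' (Finset.mem_insert_self _ _) hvj'
  let L : Finset V := Finset.univ.filter fun w => A.p w = i
  have hL : ∀ w, w ∈ L ↔ A.p w = i := by intro w; simp [L]
  let B : V → V → MvPolynomial V F := fun c w => A.imm (insert w (insert c D))
  have hB : ∀ u, A.p u = i → ∀ c ∈ T, ∀ w ∈ L, NoVar u (B c w) := by
    intro u hu c _ w hw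
    exact A.noVar_imm (Finset.mem_insert_self _ _) (((hL w).1 hw).trans hu.symm)
  have hrel : ∑ w ∈ L, ∑ c ∈ T, g c * X w * B c w = 0 := by
    rw [Finset.sum_comm, ← h.rel]
    refine Finset.sum_congr rfl fun c hc => ?_
    rw [A.imm_expand (E := insert c D) (i := i), Finset.mul_sum]
    · refine Finset.sum_congr rfl fun w _ => ?_
      simp only [B]; ring
    · intro e he
      rcases Finset.mem_insert.1 he with rfl | he
      · exact hi e (Finset.mem_union_right _ hc)
      · exact hi e (Finset.mem_union_left _ he)
  obtain ⟨lo, hi', hle, hbd, hnzlo, hnzhi⟩ := exists_extr h.nz v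
  have hhi := top_step ((hL v).2 hvi) (hB v hvi) (fun c hc m hm => (hbd c hc m hm).2) hrel
  rcases hle.lt_or_eq with hlt | heq
  · have hlow := low_step ((hL v).2 hvi) (hB v hvi) (fun c hc m hm => (hbd c hc m hm).1) hrel
    obtain ⟨_, hi2, _, hbd2, _, hnz2⟩ := exists_extr hnzlo v'
    have hhi2 := top_step (v := v') (Finset.mem_erase.2 ⟨hvv', (hL v').2 hvi'⟩)
      (fun c hc w hw => hB v' hvi' c hc w (Finset.mem_of_mem_erase hw))
      (fun c hc m hm => (hbd2 c hc m hm).2) hlow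
    have hsum : tot T (fun c => vcomp v hi' (g c)) +
        tot T (fun c => vcomp v' hi2 (vcomp v lo (g c))) ≤ tot T g := by
      unfold tot
      rw [← Finset.sum_add_distrib]
      refine Finset.sum_le_sum fun c _ => ?_
      exact (Nat.add_le_add_left (card_vcomp_le _ _ _) _).trans
        (card_vcomp_add_le v hlt.ne' (g c))
    by_cases hcase : 2 * tot T (fun c => vcomp v hi' (g c)) ≤ tot T g
    · exact ⟨v, T, _, h.extend subset_rfl (hpT v hvi) (hpD v hvi) hqT hqD hnzhi hhi,
        hvD v hvi, Or.inl ⟨le_rfl, hcase⟩⟩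
    · exact ⟨v', T, _, h.extend subset_rfl (hpT v' hvi') (hpD v' hvi') hqT' hqD' hnz2 hhi2,
        hvD v' hvi', Or.inl ⟨le_rfl, by omega⟩⟩
  · subst heq
    have hfull : ∑ c ∈ T, g c * B c v = 0 := by
      rw [← hhi]
      refine Finset.sum_congr rfl fun c hc => ?_
      rw [vcomp_eq_self]
      intro m hm
      have := hbd c hc m hm
      omega
    obtain ⟨lo1, hi1, hle1, hbd1, hnzlo1, hnzhi1⟩ := exists_extr h.nz v₁
    rcases hle1.lt_or_eq with hlt | heq
    · have hex : ∀ e, ∑ c ∈ T, vcomp v₁ e (g c) * B c v = 0 := by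
        intro e
        have := congrArg (vcomp v₁ e) hfull
        rw [map_sum, map_zero] at this
        rw [← this]
        exact Finset.sum_congr rfl fun c hc => (hB v₁ hvi₁ c hc v ((hL v).2 hvi) e (g c)).symm
      have hsum : tot T (fun c => vcomp v₁ lo1 (g c)) +
          tot T (fun c => vcomp v₁ hi1 (g c)) ≤ tot T g := by
        unfold tot
        rw [← Finset.sum_add_distrib]
        exact Finset.sum_le_sum fun c _ => card_vcomp_add_le v₁ hlt.ne (g c)
      by_cases hcase : 2 * tot T (fun c => vcomp v₁ lo1 (g c)) ≤ tot T g
      · exact ⟨v, T, _, h.extend subset_rfl (hpT v hvi) (hpD v hvi) hqT hqD hnzlo1 (hex lo1),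
          hvD v hvi, Or.inl ⟨le_rfl, hcase⟩⟩
      · exact ⟨v, T, _, h.extend subset_rfl (hpT v hvi) (hpD v hvi) hqT hqD hnzhi1 (hex hi1),
          hvD v hvi, Or.inl ⟨le_rfl, by omega⟩⟩
    · subst heq
      have hhi1 := top_step ((hL v₁).2 hvi₁) (hB v₁ hvi₁)
        (fun c hc m hm => (hbd1 c hc m hm).2) hrel
      have hfull1 : ∑ c ∈ T with A.q c ≠ A.q v₁, g c * B c v₁ = 0 := by
        rw [← hhi1, Finset.sum_filter]
        refine Finset.sum_congr rfl fun c hc => ?_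
        split_ifs with hcq
        · rw [vcomp_eq_self]
          intro m hm
          have := hbd1 c hc m hm
          omega
        · simp only [B]
          rw [A.imm_eq_zero (v := v₁) (w := c) (Finset.mem_insert_self _ _)
            (Finset.mem_insert_of_mem (Finset.mem_insert_self _ _)), mul_zero]
          · rintro rfl
            exact hpT v₁ hvi₁ v₁ hc rfl
          · simpa using (not_not.1 hcq).symm
      refine ⟨v₁, T.filter fun c => A.q c ≠ A.q v₁, g,
        h.extend (Finset.filter_subset _ _) (hpT v₁ hvi₁) (hpD v₁ hvi₁)
        (fun c hc => (Finset.mem_filter.1 hc).2) hqD₁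
        ⟨c₂, Finset.mem_filter.2 ⟨hc₂, by rw [hvj₁]; exact hne.symm⟩, hgc₂⟩ hfull1,
        hvD v₁ hvi₁, Or.inr ⟨?_, ?_⟩⟩
      · apply Nat.succ_le_of_lt
        apply Finset.card_lt_card
        refine Finset.filter_ssubset.2 ⟨c₁, hc₁, by simp [hvj₁]⟩
      · exact Finset.sum_le_sum_of_subset (Finset.filter_subset _ _)

theorem main_bound (N : ℕ) : ∀ (A : Sys V I P F) (D T : Finset V) (g : V → MvPolynomial V F),
    A.Rel D T g → D.card + N ≤ Fintype.card I → 2 ^ N ≤ (2 ^ T.card * tot T g) ^ 2 := by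
  classical
  induction N with
  | zero =>
    intro A D T g h _
    have := tot_pos h.nz
    exact Nat.one_le_pow _ _ (by positivity)
  | succ N ih =>
    intro A D T₀ g h₀ hN
    obtain ⟨T, hTT, hnz, h⟩ : ∃ T ⊆ T₀, (∀ c ∈ T, g c ≠ 0) ∧ A.Rel D T g := by
      refine ⟨T₀.filter fun c => g c ≠ 0, Finset.filter_subset _ _,
        fun c hc => (Finset.mem_filter.1 hc).2, h₀.dp, h₀.dq,
        fun c hc => h₀.tp c (Finset.mem_filter.1 hc).1,
        fun c hc => h₀.tq c (Finset.mem_filter.1 hc).1, ?_, ?_⟩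
      · obtain ⟨c, hc, h1⟩ := h₀.nz
        exact ⟨c, Finset.mem_filter.2 ⟨hc, h1⟩, h1⟩
      · refine Eq.trans ?_ h₀.rel
        refine Finset.sum_subset (Finset.filter_subset _ _) fun c hc hc' => ?_
        have : g c = 0 := by
          by_contra h1; exact hc' (Finset.mem_filter.2 ⟨hc, h1⟩)
        rw [this, zero_mul]
    have htt : tot T g ≤ tot T₀ g := Finset.sum_le_sum_of_subset hTT
    suffices hs : 2 ^ (N + 1) ≤ (2 ^ T.card * tot T g) ^ 2 from
      hs.trans (Nat.pow_le_pow_left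
        (Nat.mul_le_mul (Nat.pow_le_pow_right (by norm_num) (Finset.card_le_card hTT)) htt) 2)
    have h1 := tot_pos h.nz
    by_cases hsmall : N + 1 ≤ 2 * T.card
    · calc 2 ^ (N + 1) ≤ 2 ^ (2 * T.card) := Nat.pow_le_pow_right (by norm_num) hsmall
        _ = (2 ^ T.card * 1) ^ 2 := by rw [mul_one, ← pow_mul, mul_comm]
        _ ≤ _ := Nat.pow_le_pow_left (Nat.mul_le_mul_left _ h1) 2
    have hTpos : 1 ≤ T.card := by
      obtain ⟨c, hc, _⟩ := h.nz
      exact Finset.card_pos.2 ⟨c, hc⟩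
    have hcard : D.card + T.card + 1 < Fintype.card I := by omega
    have hstep : ∃ (A' : Sys V I P F) (v : V) (T' : Finset V) (g' : V → MvPolynomial V F),
        A'.Rel (insert v D) T' g' ∧ v ∉ D ∧
        ((T'.card ≤ T.card ∧ 2 * tot T' g' ≤ tot T g) ∨
        (T'.card + 1 ≤ T.card ∧ tot T' g' ≤ tot T g)) := by
      rcases hTpos.eq_or_lt with h2 | h2
      · exfalso
        obtain ⟨c, rfl⟩ := Finset.card_eq_one.1 h2.symm
        have hr := h.rel
        rw [Finset.sum_singleton] at hr
        have hc := Finset.mem_singleton_self c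
        refine A.imm_ne_zero ?_ ?_ ((mul_eq_zero.1 hr).resolve_left (hnz c hc))
        · rw [Finset.coe_insert, Set.injOn_insert]
          · refine ⟨h.dp, ?_⟩
            rintro ⟨d, hd, he⟩
            exact h.tp c hc d hd he.symm
          · intro hv; exact h.tp c hc c hv rfl
        · rw [Finset.coe_insert, Set.injOn_insert]
          · refine ⟨h.dq, ?_⟩
            rintro ⟨d, hd, he⟩
            exact h.tq c hc d hd he.symm
          · intro hv; exact h.tp c hc c hv rfl
      · obtain ⟨c₁, hc₁, c₂, hc₂, hne⟩ := Finset.one_lt_card.1 h2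
        by_cases hq : A.q c₁ = A.q c₂
        · have hp : A.p c₁ ≠ A.p c₂ := fun hp => hne (A.uniq _ _ hp hq)
          exact ⟨A.swap, row_step h.swap hcard hc₁ hc₂ (hnz _ hc₂) hp⟩
        · exact ⟨A, row_step h hcard hc₁ hc₂ (hnz _ hc₂) hq⟩
    obtain ⟨A', v, T', g', h', hvD, hor⟩ := hstep
    have hI := ih A' (insert v D) T' g' h' (by rw [Finset.card_insert_of_notMem hvD]; omega)
    have key : 2 * (2 ^ T'.card * tot T' g') ≤ 2 ^ T.card * tot T g := by
      rcases hor with ⟨h3, h4⟩ | ⟨h3, h4⟩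
      · calc 2 * (2 ^ T'.card * tot T' g') = 2 ^ T'.card * (2 * tot T' g') := by ring
          _ ≤ _ := Nat.mul_le_mul (Nat.pow_le_pow_right (by norm_num) h3) h4
      · calc 2 * (2 ^ T'.card * tot T' g') = 2 ^ (T'.card + 1) * tot T' g' := by ring
          _ ≤ _ := Nat.mul_le_mul (Nat.pow_le_pow_right (by norm_num) h3) h4
    calc 2 ^ (N + 1) = 2 * 2 ^ N := by ring
      _ ≤ 2 * (2 ^ T'.card * tot T' g') ^ 2 := Nat.mul_le_mul_left _ hI
      _ ≤ (2 * (2 ^ T'.card * tot T' g')) ^ 2 := by nlinarith [sq_nonneg (2 ^ T'.card * tot T' g')]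
      _ ≤ _ := Nat.pow_le_pow_left key 2

end Sys

section Jac
variable {V F : Type*} [Field F]

theorem pderiv_aeval_chain {ι : Type*} [Fintype ι] (f : ι → MvPolynomial V F)
    (Q : MvPolynomial ι F) (v : V) :
    pderiv v (aeval f Q) = ∑ i, aeval f (pderiv i Q) * pderiv v (f i) := by
  classical
  induction Q using MvPolynomial.induction_on with
  | C a => simp [algebraMap_eq]
  | add p q hp hq => simp only [map_add, hp, hq, add_mul, Finset.sum_add_distrib]
  | mul_X p j hp =>
    simp only [map_mul, aeval_X, Derivation.leibniz, smul_eq_mul, hp, map_add, add_mul,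
      Finset.sum_add_distrib, pderiv_X]
    congr 1
    · rw [Finset.sum_eq_single j]
      · simp
      · intro b _ hb
        simp [hb.symm]
      · simp
    · rw [Finset.mul_sum]
      refine Finset.sum_congr rfl fun i _ => by ring

theorem totalDegree_pderiv_lt {ι : Type*} (Q : MvPolynomial ι F) (i : ι) (d : ℕ)
    (hQ : Q.totalDegree ≤ d + 1) : (pderiv i Q).totalDegree ≤ d := by
  classical
  unfold totalDegree
  refine Finset.sup_le fun m hm => ?_
  have h1 : coeff (m + Finsupp.single i 1) Q ≠ 0 := by
    intro h0
    rw [mem_support_iff, coeff_pderiv, h0] at hm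
    simp at hm
  have h2 := le_totalDegree (mem_support_iff.2 h1)
  rw [Finsupp.sum_add_index' (by simp) (by simp), Finsupp.sum_single_index (by simp)] at h2
  omega

theorem algInd_of_jac [CharZero F] {ι : Type*} [Fintype ι] (f : ι → MvPolynomial V F)
    (h : LinearIndependent (FractionRing (MvPolynomial V F))
      (fun i : ι => fun v : V => algebraMap (MvPolynomial V F)
        (FractionRing (MvPolynomial V F)) (pderiv v (f i)))) :
    AlgebraicIndependent F f := by
  classical
  rw [algebraicIndependent_iff]
  suffices H : ∀ d : ℕ, ∀ Q : MvPolynomial ι F, Q.totalDegree ≤ d → aeval f Q = 0 → Q = 0 from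
    fun Q hQ => H _ Q le_rfl hQ
  have hconst : ∀ Q : MvPolynomial ι F, Q.totalDegree = 0 → aeval f Q = 0 → Q = 0 := by
    intro Q hQ h0
    rw [totalDegree_eq_zero_iff_eq_C] at hQ
    rw [hQ] at h0 ⊢
    simpa [algebraMap_eq] using h0
  intro d
  induction d with
  | zero => exact fun Q hQ => hconst Q (by omega)
  | succ d ih =>
    intro Q hQ h0
    have hz : ∀ i, pderiv i Q = 0 := by
      have hli := Fintype.linearIndependent_iff.1 h
        (fun i => algebraMap _ _ (aeval f (pderiv i Q))) (by
          ext v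
          have := pderiv_aeval_chain f Q v
          rw [h0, map_zero] at this
          simp only [Finset.sum_apply, Pi.smul_apply, smul_eq_mul, Pi.zero_apply]
          simp_rw [← map_mul]
          rw [← map_sum, ← this, map_zero])
      intro i
      refine ih _ (totalDegree_pderiv_lt Q i d hQ) ?_
      have := hli i
      exact (IsFractionRing.injective (MvPolynomial V F)
        (FractionRing (MvPolynomial V F))) (by rw [this, map_zero])
    apply hconst Q _ h0
    apply Nat.eq_zero_of_le_zero
    unfold totalDegree
    refine Finset.sup_le fun m hm => ?_
    by_contra hne
    have : m ≠ 0 := by rintro rfl; simp at hne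
    obtain ⟨i, hi⟩ := Finsupp.ne_iff.1 this
    have hi' : m i ≠ 0 := by simpa using hi
    have hc := congrArg (coeff (m - Finsupp.single i 1)) (hz i)
    have hmm : m - Finsupp.single i 1 + Finsupp.single i 1 = m :=
      tsub_add_cancel_of_le (by simpa [Finsupp.single_le_iff] using Nat.one_le_iff_ne_zero.2 hi')
    rw [coeff_pderiv, hmm, coeff_zero] at hc
    rcases mul_eq_zero.1 hc with hc | hc
    · exact mem_support_iff.1 hm hc
    · have : ((((m - Finsupp.single i 1 : _ →₀ ℕ) i) + 1 : ℕ) : F) = 0 := by exact_mod_cast hc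
      exact absurd (Nat.cast_eq_zero.1 this) (by omega)

theorem exists_minor {K : Type*} [Field K] {V : Type*} [Fintype V] {k : ℕ} (M : Fin k → V → K)
    (h : LinearIndependent K M) :
    ∃ u : Fin k → V, Function.Injective u ∧ (Matrix.of fun a b => M a (u b)).det ≠ 0 := by
  classical
  let A : Matrix (Fin k) V K := Matrix.of M
  have hr : A.rank = k := by
    have : LinearIndependent K A.row := h
    simpa using this.rank_matrix
  rw [Matrix.rank_eq_finrank_span_cols] at hr
  obtain ⟨κ, a, ha, hs, hl⟩ := exists_linearIndependent' K A.col
  have : Fintype κ := Fintype.ofInjective a ha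
  rw [← hs, finrank_span_eq_card hl] at hr
  let e : Fin k ≃ κ := (Fintype.equivFinOfCardEq hr).symm
  refine ⟨a ∘ e, ha.comp e.injective, ?_⟩
  have hl2 := hl.comp e e.injective
  have : LinearIndependent K (Matrix.of fun x y => M x ((a ∘ e) y)).col := hl2
  rw [Matrix.linearIndependent_cols_iff_isUnit, Matrix.isUnit_iff_isUnit_det] at this
  exact this.ne_zero

theorem card_support_mul_le' (p q : MvPolynomial V F) :
    (p * q).support.card ≤ p.support.card * q.support.card := by
  classical
  exact (Finset.card_le_card (support_mul p q)).trans Finset.card_add_le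

theorem card_support_sum_le {ι : Type*} (s : Finset ι) (p : ι → MvPolynomial V F) :
    (∑ i ∈ s, p i).support.card ≤ ∑ i ∈ s, (p i).support.card := by
  classical
  exact (Finset.card_le_card support_sum).trans Finset.card_biUnion_le

theorem card_support_prod_le {ι : Type*} (s : Finset ι) (p : ι → MvPolynomial V F) :
    (∏ i ∈ s, p i).support.card ≤ ∏ i ∈ s, (p i).support.card := by
  classical
  induction s using Finset.induction_on with
  | empty => simp
  | insert a s ha ih =>
    rw [Finset.prod_insert ha, Finset.prod_insert ha]
    exact (card_support_mul_le' _ _).trans (Nat.mul_le_mul_left _ ih)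

theorem card_support_pderiv_le (v : V) (p : MvPolynomial V F) :
    (pderiv v p).support.card ≤ p.support.card := by
  classical
  refine Finset.card_le_card_of_injOn (fun m => m + Finsupp.single v 1) ?_
    (fun a _ b _ h => add_right_cancel h)
  intro m hm
  have hm : m ∈ (pderiv v p).support := hm
  show m + Finsupp.single v 1 ∈ p.support
  rw [mem_support_iff, coeff_pderiv] at hm
  exact mem_support_iff.2 (left_ne_zero_of_mul hm)

theorem card_support_unit_mul (u : ℤˣ) (p : MvPolynomial V F) :
    (u • p).support.card = p.support.card := by
  rcases Int.units_eq_one_or u with rfl | rfl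
  · simp
  · simp

theorem card_support_det_le {k s : ℕ} (M : Matrix (Fin k) (Fin k) (MvPolynomial V F))
    (h : ∀ a b, (M a b).support.card ≤ s) : M.det.support.card ≤ k.factorial * s ^ k := by
  rw [Matrix.det_apply]
  refine (card_support_sum_le _ _).trans ?_
  refine (Finset.sum_le_card_nsmul _ _ (s ^ k) ?_).trans ?_
  · intro σ _
    rw [card_support_unit_mul]
    refine (card_support_prod_le _ _).trans ?_
    refine (Finset.prod_le_pow_card _ _ s fun i _ => h _ _).trans (by simp)
  · simp [Finset.card_univ, Fintype.card_perm]

theorem pderiv_prod_X [DecidableEq V] (v : V) (G : Finset V) :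
    pderiv v (∏ c ∈ G, X c : MvPolynomial V F) =
      if v ∈ G then ∏ c ∈ G \ {v}, X c else 0 := by
  induction G using Finset.induction_on with
  | empty => simp
  | insert a G ha ih =>
    rw [Finset.prod_insert ha, pderiv_mul, ih]
    by_cases hav : a = v
    · subst hav
      rw [if_neg ha, pderiv_X_self, if_pos (Finset.mem_insert_self _ _)]
      rw [show insert a G \ {a} = G by
        ext x; simp only [Finset.mem_sdiff, Finset.mem_insert, Finset.mem_singleton]
        constructor
        · tauto
        · intro hx; exact ⟨Or.inr hx, fun h => ha (h ▸ hx)⟩]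
      ring
    · rw [pderiv_X_of_ne hav, zero_mul, zero_add]
      by_cases hv : v ∈ G
      · rw [if_pos hv, if_pos (Finset.mem_insert_of_mem hv)]
        rw [show insert a G \ {v} = insert a (G \ {v}) by
          ext x; simp only [Finset.mem_sdiff, Finset.mem_insert, Finset.mem_singleton]
          constructor
          · tauto
          · rintro (rfl | h)
            · exact ⟨Or.inl rfl, hav⟩
            · exact ⟨Or.inr h.1, h.2⟩]
        rw [Finset.prod_insert (fun h => ha (Finset.mem_sdiff.1 h).1)]
      · rw [if_neg hv, if_neg, mul_zero]
        simp [hv, Ne.symm hav]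

end Jac

/-- the system attached to the immanant -/
noncomputable def immSys {F : Type*} [Field F] {n : ℕ} (χ : Equiv.Perm (Fin n) →* Fˣ) :
    Sys (Fin n × Fin n) (Fin n) (Equiv.Perm (Fin n)) F where
  p := Prod.fst
  q := Prod.snd
  gr := fun σ => Finset.univ.image fun i => (i, σ i)
  a := fun σ => (χ σ : F)
  ha := fun σ => (χ σ).ne_zero
  inj := by
    intro σ τ h
    ext i
    have h1 : (i, σ i) ∈ Finset.univ.image fun i => (i, τ i) := by
      have h0 : (i, σ i) ∈ Finset.univ.image fun i => (i, σ i) := by simp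
      exact (Finset.ext_iff.1 h (i, σ i)).1 h0
    simp at h1
    rw [h1]
  pinj := by
    intro σ x hx y hy hxy
    simp only [Finset.coe_image, Set.mem_image] at hx hy
    obtain ⟨a, -, rfl⟩ := hx
    obtain ⟨b, -, rfl⟩ := hy
    have : a = b := hxy
    rw [this]
  qinj := by
    intro σ x hx y hy hxy
    simp only [Finset.coe_image, Set.mem_image] at hx hy
    obtain ⟨a, -, rfl⟩ := hx
    obtain ⟨b, -, rfl⟩ := hy
    have : a = b := σ.injective hxy
    rw [this]
  psurj := by
    intro σ i
    exact ⟨(i, σ i), by simp, rfl⟩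
  qsurj := by
    intro σ i
    exact ⟨(σ.symm i, i), by simp, rfl⟩
  ext := by
    classical
    intro E hp hq
    let e : Fin n → Fin n := fun i => if h : ∃ j, (i, j) ∈ E then h.choose else i
    have he : ∀ x ∈ E, e x.1 = x.2 := by
      intro x hx
      have h : ∃ j, (x.1, j) ∈ E := ⟨x.2, hx⟩
      simp only [e, dif_pos h]
      have := hp h.choose_spec hx rfl
      exact congrArg Prod.snd this
    obtain ⟨g, hg⟩ := Finset.exists_equiv_extend_of_card_eq (α := Fin n) (β := Fin n)
      (t := Finset.univ) (by simp) (s := E.image Prod.fst) (f := e) (by simp) (by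
        intro a ha b hb hab
        simp only [Finset.coe_image, Set.mem_image] at ha hb
        obtain ⟨x, hx, rfl⟩ := ha
        obtain ⟨y, hy, rfl⟩ := hb
        rw [he x hx, he y hy] at hab
        rw [hq hx hy hab])
    refine ⟨g.trans (Equiv.subtypeUnivEquiv (by simp)), ?_⟩
    intro x hx
    have := hg x.1 (Finset.mem_image_of_mem _ hx)
    rw [he x hx] at this
    refine Finset.mem_image.2 ⟨x.1, Finset.mem_univ _, ?_⟩
    refine Prod.ext rfl ?_
    simpa using this
  cell := fun i j => ⟨(i, j), rfl, rfl⟩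
  uniq := fun v w h1 h2 => Prod.ext h1 h2

theorem pderiv_imm {F : Type*} [Field F] {n : ℕ} (χ : Equiv.Perm (Fin n) →* Fˣ)
    (v : Fin n × Fin n) :
    pderiv v (∑ σ : Equiv.Perm (Fin n), MvPolynomial.C ((χ σ : Fˣ) : F) *
          ∏ i : Fin n, (X (i, σ i) : MvPolynomial (Fin n × Fin n) F)) =
      (immSys χ).imm (insert v ∅) := by
  classical
  unfold Sys.imm
  rw [map_sum, Finset.sum_filter]
  refine Finset.sum_congr rfl fun σ _ => ?_
  have hprod : (∏ i : Fin n, (X (i, σ i) : MvPolynomial (Fin n × Fin n) F)) =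
      ∏ c ∈ (immSys χ).gr σ, X c := by
    show _ = ∏ c ∈ Finset.univ.image fun i => (i, σ i), X c
    rw [Finset.prod_image]
    intro a _ b _ h
    exact congrArg Prod.fst h
  rw [pderiv_C_mul, hprod, pderiv_prod_X]
  simp only [insert_empty_eq, Finset.singleton_subset_iff]
  split_ifs
  · rfl
  · simp

theorem statement11 {F : Type*} [Field F] [CharZero F] {n m s r : ℕ}
    (hn : 1 ≤ n) (hrn : r < n)
    (χ : Equiv.Perm (Fin n) →* Fˣ)
    (f : Fin m → MvPolynomial (Fin n × Fin n) F)
    (C : MvPolynomial (Fin m) F)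
    (hImm : ∑ σ : Equiv.Perm (Fin n),
        MvPolynomial.C ((χ σ : Fˣ) : F) *
          ∏ i : Fin n, (X (i, σ i) : MvPolynomial (Fin n × Fin n) F) =
      aeval f C)
    (hsp : ∀ i, (f i).support.card ≤ s)
    (htd : trdegFam F f ≤ r) :
    (2 : ℝ) ^ ((n : ℝ) / 2 - r - 1) ≤ (Nat.factorial (r + 1) : ℝ) * (s : ℝ) ^ r := by
  classical
  let V := Fin n × Fin n
  let R := MvPolynomial V F
  let K := FractionRing R
  have hKinj : Function.Injective (algebraMap R K) := IsFractionRing.injective R K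
  let A := immSys χ
  -- the derivatives
  have hder : ∀ v : V, A.imm (insert v ∅) = ∑ i, aeval f (pderiv i C) * pderiv v (f i) := by
    intro v
    rw [← pderiv_aeval_chain, ← hImm, pderiv_imm]
  have hs1 : 1 ≤ s := by
    by_contra hs0
    have hf0 : ∀ i, f i = 0 := fun i => by
      have := hsp i
      exact support_eq_empty.1 (Finset.card_eq_zero.1 (by omega))
    have h0 := hder (⟨0, hn⟩, ⟨0, hn⟩)
    simp only [hf0, map_zero, mul_zero, Finset.sum_const_zero] at h0
    exact A.imm_ne_zero (by simp) (by simp) h0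
  let gr : Fin m → V → K := fun i v => algebraMap R K (pderiv v (f i))
  obtain ⟨b, -, -, hspan, hli⟩ := exists_linearIndepOn_extension (K := K) (v := gr)
    (s := ∅) (t := Set.univ) (linearIndepOn_empty K gr) (Set.empty_subset _)
  let S : Finset (Fin m) := b.toFinset
  let k := S.card
  let e : Fin k ≃ {x // x ∈ S} := S.equivFin.symm
  have hli' : LinearIndependent K (fun i : {x // x ∈ S} => gr i) := by
    refine hli.comp (fun i : {x // x ∈ S} => (⟨i.1, Set.mem_toFinset.1 i.2⟩ : b)) ?_
    intro x y h
    exact Subtype.ext (by simpa using h)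
  have hk : k ≤ r := by
    refine le_trans ?_ htd
    unfold trdegFam
    refine le_csSup ⟨m, ?_⟩ ⟨S, rfl, algInd_of_jac _ hli'⟩
    rintro _ ⟨S', rfl, -⟩
    simpa using Finset.card_le_univ S'
  let row : Fin k → V → K := fun a => gr (e a)
  have hrow : LinearIndependent K row := hli'.comp e e.injective
  obtain ⟨u, hu, hdet⟩ := exists_minor row hrow
  obtain ⟨w, hw⟩ : ∃ w : V, w ∉ Finset.univ.image u := by
    by_contra hcon
    push Not at hcon
    have h1 : (Finset.univ : Finset V) ⊆ Finset.univ.image u := fun x _ => hcon x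
    have h2 := (Finset.card_le_card h1).trans Finset.card_image_le
    simp only [Finset.card_univ, Fintype.card_prod, Fintype.card_fin, V] at h2
    nlinarith
  let col : Fin (k + 1) → V := Fin.cons w u
  have hcol : Function.Injective col := by
    refine Fin.cons_injective_iff.2 ⟨?_, hu⟩
    simpa using hw
  let M : Matrix (Fin (k + 1)) (Fin (k + 1)) R :=
    Matrix.of (Fin.cons (fun j => A.imm (insert (col j) ∅))
      (fun a j => pderiv (col j) (f (e a))))
  have hM0 : ∀ j, M 0 j = A.imm (insert (col j) ∅) := fun j => rfl
  have hMs : ∀ a j, M (Fin.succ a) j = pderiv (col j) (f (e a)) := fun a j => rfl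
  -- the determinant vanishes
  have hMdet : M.det = 0 := by
    apply hKinj
    rw [map_zero, RingHom.map_det]
    have hmem : (fun v => algebraMap R K (A.imm (insert v ∅))) ∈ Submodule.span K (Set.range row) := by
      have h1 : ∀ i, gr i ∈ Submodule.span K (Set.range row) := by
        intro i
        refine Submodule.span_mono ?_ (hspan ⟨i, Set.mem_univ _, rfl⟩)
        rintro _ ⟨x, hx, rfl⟩
        have hxS : x ∈ S := by simpa [S] using hx
        exact ⟨e.symm ⟨x, hxS⟩, by simp [row]⟩
      have h2 : (fun v => algebraMap R K (A.imm (insert v ∅))) =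
          ∑ i, algebraMap R K (aeval f (pderiv i C)) • gr i := by
        ext v
        simp only [hder, map_sum, map_mul, Finset.sum_apply, Pi.smul_apply, smul_eq_mul, gr]
      rw [h2]
      exact Submodule.sum_mem _ fun i _ => Submodule.smul_mem _ _ (h1 i)
    obtain ⟨a, ha⟩ := (Submodule.mem_span_range_iff_exists_fun K).1 hmem
    by_contra hne
    have hind := Matrix.linearIndependent_rows_of_det_ne_zero hne
    have := Fintype.linearIndependent_iff.1 hind (Fin.cons (-1) a) (by
      ext j
      rw [Fin.sum_univ_succ]
      have := congrFun ha (col j)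
      simp only [Finset.sum_apply, Pi.smul_apply, smul_eq_mul] at this
      simp only [Fin.cons_zero, Fin.cons_succ, Pi.add_apply, Finset.sum_apply, Pi.smul_apply,
        smul_eq_mul, Pi.zero_apply, RingHom.mapMatrix_apply, Matrix.map_apply, hM0, hMs]
      rw [← this]
      simp only [row, gr]
      ring) 0
    simp at this
  -- the relation
  let minor : Fin (k + 1) → R := fun j => (-1) ^ (j : ℕ) * (M.submatrix Fin.succ j.succAbove).det
  have hrel : ∑ j, minor j * A.imm (insert (col j) ∅) = 0 := by
    rw [← hMdet, Matrix.det_succ_row_zero]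
    refine Finset.sum_congr rfl fun j _ => ?_
    simp only [minor, hM0]; ring
  let T : Finset V := Finset.univ.image col
  let g : V → R := Function.extend col minor 0
  have hg : ∀ j, g (col j) = minor j := fun j => hcol.extend_apply _ _ _
  have hRel : A.Rel ∅ T g := by
    refine ⟨by simp, by simp, by simp, by simp, ⟨col 0, by simp [T], ?_⟩, ?_⟩
    · rw [hg]
      simp only [minor, Fin.val_zero, pow_zero, one_mul]
      intro h0
      apply hdet
      have := congrArg (algebraMap R K) h0
      rw [map_zero, RingHom.map_det] at this
      rw [← this]
      congr 1
    · rw [Finset.sum_image hcol.injOn, ← hrel]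
      exact Finset.sum_congr rfl fun j _ => by rw [hg]
  have hTcard : T.card = k + 1 := by
    rw [Finset.card_image_of_injective _ hcol]; simp
  have hminor : ∀ j, (minor j).support.card ≤ k.factorial * s ^ k := by
    intro j
    have h1 : (minor j).support.card = (M.submatrix Fin.succ j.succAbove).det.support.card := by
      simp only [minor]
      rcases neg_one_pow_eq_or R (j : ℕ) with h | h
      · rw [h, one_mul]
      · rw [h, neg_one_mul]
        exact congrArg Finset.card (support_neg (R := F) (σ := V))
    rw [h1]
    refine card_support_det_le _ fun a b => ?_
    exact (card_support_pderiv_le _ _).trans (hsp _)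
  have htot : Sys.tot T g ≤ (r + 1).factorial * s ^ r := by
    unfold Sys.tot
    rw [Finset.sum_image hcol.injOn]
    refine (Finset.sum_le_card_nsmul _ _ (k.factorial * s ^ k)
      (fun j _ => by rw [hg]; exact hminor j)).trans ?_
    rw [Finset.card_univ, Fintype.card_fin, smul_eq_mul, ← mul_assoc, ← Nat.factorial_succ]
    exact Nat.mul_le_mul (Nat.factorial_le (by omega)) (Nat.pow_le_pow_right hs1 hk)
  have hmain := Sys.main_bound n A ∅ T g hRel (by simp)
  rw [hTcard] at hmain
  have hmain2 : 2 ^ n ≤ (2 ^ (r + 1) * ((r + 1).factorial * s ^ r)) ^ 2 :=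
    hmain.trans (Nat.pow_le_pow_left (Nat.mul_le_mul
      (Nat.pow_le_pow_right (by norm_num) (by omega)) htot) 2)
  have hreal : (2 : ℝ) ^ n ≤ (2 ^ (r + 1) * ((Nat.factorial (r + 1) : ℝ) * (s : ℝ) ^ r)) ^ 2 := by
    exact_mod_cast hmain2
  have hsq : ((2 : ℝ) ^ ((n : ℝ) / 2)) ^ 2 = 2 ^ n := by
    rw [← Real.rpow_natCast, ← Real.rpow_mul (by norm_num), ← Real.rpow_natCast]
    congr 1; push_cast; ring
  rw [← hsq] at hreal
  have hfin := le_of_sq_le_sq hreal (by positivity)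
  have hsplit : (2 : ℝ) ^ ((n : ℝ) / 2 - r - 1) = 2 ^ ((n : ℝ) / 2) / 2 ^ (r + 1) := by
    rw [show (n : ℝ) / 2 - r - 1 = (n : ℝ) / 2 - ((r + 1 : ℕ) : ℝ) by push_cast; ring,
      Real.rpow_sub (by norm_num), Real.rpow_natCast]
  rw [hsplit, div_le_iff₀ (by positivity)]
  linarith
end

section
/- Let F be a field of characteristic zero, n ≥ 1, χ : S_n → F^× a group homomorphism, and Imm_n = Σ_{σ ∈ S_n} χ(σ) ∏_{i=1}^{n} x_{i,σ(i)} ∈ F[x_{ij}]. Suppose Imm_n = C(T_1, …, T_m) for some polynomial C ∈ F[y_1, …, y_m], where each T_i ∈ F[x_{ij}] is a product of polynomials of total degree at most 1. Then 2 · trdeg_F{T_1, …, T_m} ≥ n − 1. -/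
open MvPolynomial

theorem indep_insert_of_kill {F A B ι : Type*} [Field F] [CommRing A] [IsDomain A] [CommRing B]
    [Algebra F A] [Algebra F B] (T : ι → A) (ψ : A →ₐ[F] B) (i : ι) (hi : T i ≠ 0)
    (hψ : ψ (T i) = 0) (S : Set ι) (hiS : i ∉ S)
    (hS : AlgebraicIndependent F (fun j : S => ψ (T j))) :
    AlgebraicIndependent F (fun j : (insert i S : Set ι) => T j) := by
  have hS0 : AlgebraicIndependent F (fun j : S => T j) :=
    AlgebraicIndependent.of_comp ψ hS
  have hinj : ∀ a ∈ Algebra.adjoin F (T '' S), ψ a = 0 → a = 0 := by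
    intro a ha h0
    have : T '' S = Set.range (fun j : S => T j) := by
      rw [Set.image_eq_range]
    rw [this, Algebra.adjoin_range_eq_range_aeval] at ha
    obtain ⟨p, rfl⟩ := ha
    have h1 : aeval (fun j : S => ψ (T j)) p = 0 := by
      rw [← h0]
      change _ = ψ (aeval _ p)
      rw [← MvPolynomial.comp_aeval_apply]
    have h2 : p = 0 := by
      apply hS
      rw [h1, map_zero]
    rw [h2]; simp
  refine AlgebraicIndepOn.insert (s := S) (i := i) hS0 ?_
  have key : ∀ (d : ℕ) (p : Polynomial (Algebra.adjoin F (T '' S))), p.natDegree ≤ d →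
      Polynomial.aeval (T i) p = 0 → p = 0 := by
    intro d
    induction d with
    | zero =>
      intro p hp h
      rw [Polynomial.eq_C_of_natDegree_le_zero hp] at h ⊢
      rw [Polynomial.aeval_C] at h
      have : p.coeff 0 = 0 := Subtype.ext h
      rw [this]; simp
    | succ d ih =>
      intro p hp h
      have hd := Polynomial.divX_mul_X_add p
      have h2 := h
      rw [← hd] at h2
      simp only [map_add, map_mul, Polynomial.aeval_X, Polynomial.aeval_C] at h2
      have h3 := congrArg ψ h2
      simp only [map_add, map_mul, hψ, mul_zero, zero_add, map_zero] at h3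
      have h4 : p.coeff 0 = 0 := Subtype.ext (hinj _ (p.coeff 0).2 h3)
      rw [h4] at h2 hd
      simp only [map_zero, add_zero, mul_eq_zero, hi, or_false] at h2 hd
      have h5 := ih p.divX (by rw [Polynomial.natDegree_divX_eq_natDegree_tsub_one]; omega) h2
      rw [← hd, h5, zero_mul]
  rw [transcendental_iff]
  intro p hp
  exact key _ p le_rfl hp

/-- Affine-linear polynomials not involving the variables in `P`. -/
noncomputable def affSub (F : Type*) [Field F] {s : Type*} [Fintype s] (P : Finset s) :
    Submodule F (MvPolynomial s F) where
  carrier := {l | ∃ (c : F) (a : s → F), (∀ q ∈ P, a q = 0) ∧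
    l = MvPolynomial.C c + ∑ q, a q • X q}
  add_mem' := by
    rintro _ _ ⟨c, a, ha, rfl⟩ ⟨c', a', ha', rfl⟩
    refine ⟨c + c', a + a', fun q hq => by simp [ha q hq, ha' q hq], ?_⟩
    simp only [map_add, Pi.add_apply, add_smul, Finset.sum_add_distrib]
    ring
  zero_mem' := ⟨0, 0, by simp, by simp⟩
  smul_mem' := by
    rintro r _ ⟨c, a, ha, rfl⟩
    refine ⟨r * c, r • a, fun q hq => by simp [ha q hq], ?_⟩
    simp only [smul_add, Finset.smul_sum, Pi.smul_apply, smul_smul, smul_eq_mul]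
    rw [map_mul, MvPolynomial.smul_eq_C_mul]

section aff
variable {F : Type*} [Field F] {s : Type*} [Fintype s]

theorem C_mem_affSub (P : Finset s) (c : F) : MvPolynomial.C c ∈ affSub F P :=
  ⟨c, 0, by simp, by simp⟩

theorem X_mem_affSub [DecidableEq s] (P : Finset s) (q : s) (hq : q ∉ P) :
    (X q : MvPolynomial s F) ∈ affSub F P :=
  ⟨0, Pi.single q 1, by
    intro p hp
    rw [Pi.single_eq_of_ne]
    rintro rfl; exact hq hp, by simp [Pi.single_apply]⟩

theorem affSub_of_totalDegree [DecidableEq s] (l : MvPolynomial s F) (h : l.totalDegree ≤ 1) :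
    l ∈ affSub F (∅ : Finset s) := by
  rw [l.as_sum]
  refine Submodule.sum_mem _ fun v hv => ?_
  have h1 := (MvPolynomial.le_totalDegree hv).trans h
  change v.degree ≤ 1 at h1
  rcases Nat.le_one_iff_eq_zero_or_eq_one.mp h1 with h2 | h2
  · rw [Finsupp.degree_eq_zero_iff] at h2
    subst h2
    exact C_mem_affSub _ _
  · obtain ⟨q, rfl⟩ := (Finsupp.sum_eq_one_iff v).mp h2
    have : monomial (Finsupp.single q 1) (coeff (Finsupp.single q 1) l)
        = coeff (Finsupp.single q 1) l • (X q : MvPolynomial s F) := by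
      rw [X, smul_monomial]; simp
    rw [this]
    exact Submodule.smul_mem _ _ (X_mem_affSub _ _ (by simp))

theorem map_affSub [DecidableEq s] {B : Type*} [CommRing B] [Algebra F B] (φ : MvPolynomial s F →ₐ[F] B)
    (P : Finset s) (M : Submodule F B) (h1 : ∀ c, algebraMap F B c ∈ M)
    (hX : ∀ q ∉ P, φ (X q) ∈ M) (l : MvPolynomial s F) (hl : l ∈ affSub F P) : φ l ∈ M := by
  obtain ⟨c, a, ha, rfl⟩ := hl
  rw [map_add, map_sum]
  refine M.add_mem ?_ (M.sum_mem fun q _ => ?_)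
  · rw [← MvPolynomial.algebraMap_eq, φ.commutes]; exact h1 c
  · by_cases hq : q ∈ P
    · simp [ha q hq]
    · rw [map_smul]; exact M.smul_mem _ (hX q hq)

theorem exists_kill [DecidableEq s] (P : Finset s) (l : MvPolynomial s F) (hl : l ∈ affSub F P)
    (hc : ∀ c, l ≠ MvPolynomial.C c) :
    ∃ p ∉ P, ∃ ψ : MvPolynomial s F →ₐ[F] MvPolynomial s F,
      ψ (X p) ∈ affSub F (insert p P) ∧ (∀ q ≠ p, ψ (X q) = X q) ∧ ψ l = 0 := by
  obtain ⟨c, a, ha, rfl⟩ := hl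
  have : ∃ p, a p ≠ 0 := by
    by_contra! h
    exact hc c (by simp [h])
  obtain ⟨p, hp⟩ := this
  have hpP : p ∉ P := fun h => hp (ha p h)
  let R : MvPolynomial s F := MvPolynomial.C c + ∑ q ∈ Finset.univ.erase p, a q • X q
  let ψ : MvPolynomial s F →ₐ[F] MvPolynomial s F :=
    aeval (fun q => if q = p then -(a p)⁻¹ • R else X q)
  have h1 : ψ (X p) = -(a p)⁻¹ • R := by simp [ψ]
  have h2 : ∀ q ≠ p, ψ (X q) = X q := by intro q hq; simp [ψ, hq]
  refine ⟨p, hpP, ψ, ?_, h2, ?_⟩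
  · rw [h1]
    refine Submodule.smul_mem _ _ (Submodule.add_mem _ (C_mem_affSub _ _)
      (Submodule.sum_mem _ fun q hq => ?_))
    by_cases hqP : q ∈ P
    · simp [ha q hqP]
    · refine Submodule.smul_mem _ _ (X_mem_affSub _ _ ?_)
      simp [hqP, Finset.ne_of_mem_erase hq]
  · have h3 : ψ R = R := by
      simp only [R, map_add, map_sum, map_smul]
      congr 1
      · simp [ψ]
      · exact Finset.sum_congr rfl fun q hq => by rw [h2 q (Finset.ne_of_mem_erase hq)]
    have h4 : MvPolynomial.C c + ∑ q, a q • X q = a p • X p + R := by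
      rw [← Finset.add_sum_erase _ _ (Finset.mem_univ p)]
      simp only [R]; ring
    rw [h4, map_add, h3, map_smul, h1, smul_smul]
    simp [hp]

theorem main_restrict [DecidableEq s] {m : ℕ} (k : ℕ) : ∀ (P : Finset s) (T : Fin m → MvPolynomial s F),
    (∀ i, ∃ (d : ℕ) (l : Fin d → MvPolynomial s F), (∀ j, l j ∈ affSub F P) ∧ T i = ∏ j, l j) →
    (∀ S : Finset (Fin m), AlgebraicIndependent F (fun i : {x // x ∈ S} => T i) → S.card ≤ k) →
    ∃ P' : Finset s, P ⊆ P' ∧ P'.card ≤ P.card + k ∧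
      ∃ φ : MvPolynomial s F →ₐ[F] MvPolynomial s F,
        (∀ q, φ (X q) ∈ affSub F (∅ : Finset s)) ∧ (∀ q ∉ P', φ (X q) = X q) ∧
        ∀ i, ∃ c, φ (T i) = MvPolynomial.C c := by
  induction k with
  | zero =>
    intro P T hT hS
    refine ⟨P, subset_rfl, by simp, AlgHom.id F _, fun q => X_mem_affSub _ _ (by simp),
      fun q _ => rfl, fun i => ?_⟩
    by_contra! hc
    obtain ⟨d, l, hl, hTi⟩ := hT i
    have h1 : ∃ j, ∀ c, l j ≠ MvPolynomial.C c := by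
      by_contra! h
      choose c hc' using h
      exact hc (∏ j, c j) (by simp [hTi, hc'])
    obtain ⟨j, hj⟩ := h1
    obtain ⟨p, hp, ψ, hψp, hψ, hψl⟩ := exists_kill P (l j) (hl j) hj
    have hψT : ψ (T i) = 0 := by
      rw [hTi, map_prod]; exact Finset.prod_eq_zero (Finset.mem_univ j) hψl
    have hTi0 : T i ≠ 0 := fun h => hc 0 (by simp [h])
    have := indep_insert_of_kill T ψ i hTi0 hψT ∅ (by simp)
      (algebraicIndependent_empty_type)
    have := hS {i} (by
      have e : (insert i (∅ : Set (Fin m))) = (({i} : Finset (Fin m)) : Set (Fin m)) := by simp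
      rw [e] at this
      exact this)
    simp at this
  | succ k ih =>
    intro P T hT hS
    by_cases hall : ∀ i, ∃ c, T i = MvPolynomial.C c
    · exact ⟨P, subset_rfl, by omega, AlgHom.id F _, fun q => X_mem_affSub _ _ (by simp),
        fun q _ => rfl, hall⟩
    push Not at hall
    obtain ⟨i, hc⟩ := hall
    obtain ⟨d, l, hl, hTi⟩ := hT i
    have h1 : ∃ j, ∀ c, l j ≠ MvPolynomial.C c := by
      by_contra! h
      choose c hc' using h
      exact hc (∏ j, c j) (by simp [hTi, hc'])
    obtain ⟨j, hj⟩ := h1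
    obtain ⟨p, hp, ψ, hψp, hψ, hψl⟩ := exists_kill P (l j) (hl j) hj
    have hψT : ψ (T i) = 0 := by
      rw [hTi, map_prod]; exact Finset.prod_eq_zero (Finset.mem_univ j) hψl
    have hTi0 : T i ≠ 0 := fun h => hc 0 (by simp [h])
    obtain ⟨P', hPP', hcard, φ, hφ1, hφ2, hφ3⟩ := ih (insert p P) (fun i => ψ (T i)) (by
      intro i'
      obtain ⟨d, l, hl, hTi⟩ := hT i'
      refine ⟨d, fun j => ψ (l j), fun j => ?_, by rw [hTi, map_prod]⟩
      refine map_affSub ψ P _ (fun c => C_mem_affSub _ c) (fun q hq => ?_) _ (hl j)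
      by_cases hqp : q = p
      · subst hqp; exact hψp
      · rw [hψ q hqp]; exact X_mem_affSub _ _ (by simp [hqp, hq])) (by
      intro S hSi
      have hiS : i ∉ S := fun h => hSi.ne_zero ⟨i, h⟩ hψT
      have := indep_insert_of_kill T ψ i hTi0 hψT (S : Set (Fin m)) (by simpa using hiS) hSi
      have e : (insert i (S : Set (Fin m))) = ((insert i S : Finset (Fin m)) : Set (Fin m)) := by simp
      rw [e] at this
      have := hS (insert i S) this
      rw [Finset.card_insert_of_notMem hiS] at this
      omega)
    rw [Finset.card_insert_of_notMem hp] at hcard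
    refine ⟨P', (Finset.subset_insert _ _).trans hPP', by omega, φ.comp ψ, fun q => ?_,
      fun q hq => ?_, hφ3⟩
    · rw [AlgHom.comp_apply]
      by_cases hqp : q = p
      · subst hqp
        exact map_affSub φ _ _ (fun c => C_mem_affSub _ c) (fun q _ => hφ1 q) _ hψp
      · rw [hψ q hqp]; exact hφ1 q
    · have hqp : q ≠ p := by
        rintro rfl; exact hq (hPP' (Finset.mem_insert_self _ _))
      rw [AlgHom.comp_apply, hψ q hqp, hφ2 q hq]
end aff

theorem exists_perm_avoid {n : ℕ} (R S : Finset (Fin n)) (h : R.card + S.card ≤ n) :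
    ∃ σ : Equiv.Perm (Fin n), ∀ i ∈ R, σ i ∉ S := by
  have h1 : R.card ≤ (Sᶜ).card := by rw [Finset.card_compl, Fintype.card_fin]; omega
  obtain ⟨U, hU, hUc⟩ := Finset.exists_subset_card_eq h1
  let e : {x // x ∈ R} ≃ {x // x ∈ U} := Finset.equivOfCardEq hUc.symm
  refine ⟨e.extendSubtype, fun i hi => ?_⟩
  have := e.extendSubtype_mem i hi
  exact Finset.mem_compl.mp (hU this)

theorem imm_not_const {F : Type*} [Field F] {n : ℕ} (hn : 1 ≤ n)
    (χ : Equiv.Perm (Fin n) →* Fˣ) (P : Finset (Fin n × Fin n)) (hP : 2 * P.card ≤ n)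
    (φ : MvPolynomial (Fin n × Fin n) F →ₐ[F] MvPolynomial (Fin n × Fin n) F)
    (hφ1 : ∀ q, φ (X q) ∈ affSub F (∅ : Finset (Fin n × Fin n)))
    (hφ2 : ∀ q ∉ P, φ (X q) = X q) (c : F) 
    (h : φ (∑ σ : Equiv.Perm (Fin n),
        MvPolynomial.C ((χ σ : Fˣ) : F) *
          ∏ i : Fin n, (X (i, σ i) : MvPolynomial (Fin n × Fin n) F)) = MvPolynomial.C c) :
    False := by
  classical
  set R := P.image Prod.fst with hR
  set S := P.image Prod.snd with hS
  have hRc : R.card ≤ P.card := Finset.card_image_le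
  have hSc : S.card ≤ P.card := Finset.card_image_le
  obtain ⟨σ0, hσ0⟩ := exists_perm_avoid R S (by omega)
  let b : Fin n × Fin n → ℕ := fun q => 1 + (if q.1 ∈ R then 1 else 0) + (if q.2 ∈ S then 1 else 0)
  have hb : ∀ σ : Equiv.Perm (Fin n), ∑ i, b (i, σ i) = n + R.card + S.card := by
    intro σ
    simp only [b, Finset.sum_add_distrib]
    rw [Equiv.sum_comp σ (fun j => if j ∈ S then 1 else 0)]
    simp
  let y : Fin n × Fin n → Polynomial F := fun q =>
    if q.2 = σ0 q.1 then Polynomial.X ^ b q else 0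
  have hyb : ∀ q, (y q).natDegree ≤ b q := by
    intro q; simp only [y]; split_ifs <;> simp
  have hy2 : ∀ q, (y q).natDegree ≤ 2 := by
    intro q
    simp only [y]; split_ifs with hq
    · rw [Polynomial.natDegree_X_pow]
      simp only [b]
      have := hσ0 q.1
      rw [← hq] at this
      by_cases h1 : q.1 ∈ R
      · simp [h1, this h1]
      · simp only [h1, if_false]; split_ifs <;> simp
    · simp
  let ev : MvPolynomial (Fin n × Fin n) F →ₐ[F] Polynomial F := (aeval y).comp φ
  have hev1 : ∀ q ∉ P, ev (X q) = y q := by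
    intro q hq; simp [ev, hφ2 q hq]
  have hev2 : ∀ q, (ev (X q)).natDegree ≤ 2 := by
    intro q
    have : aeval y (φ (X q)) ∈ Polynomial.degreeLE F 2 :=
      map_affSub (aeval y) ∅ _ (fun c => by
        rw [Polynomial.mem_degreeLE]
        exact Polynomial.degree_C_le.trans (by norm_num)) (fun q _ => by
        rw [Polynomial.mem_degreeLE, aeval_X]
        exact Polynomial.natDegree_le_iff_degree_le.mp (hy2 q)) _ (hφ1 q)
    rw [Polynomial.mem_degreeLE] at this
    exact Polynomial.natDegree_le_iff_degree_le.mpr this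
  have hmem : ∀ q, ¬ (q.1 ∈ R ∧ q.2 ∈ S) → q ∉ P := by
    intro q hq hqP
    exact hq ⟨Finset.mem_image_of_mem _ hqP, Finset.mem_image_of_mem _ hqP⟩
  have hev3 : ∀ q, (ev (X q)).natDegree ≤ b q := by
    intro q
    by_cases hq : q.1 ∈ R ∧ q.2 ∈ S
    · refine (hev2 q).trans ?_
      simp [b, hq.1, hq.2]
    · rw [hev1 q (hmem q hq)]; exact hyb q
  have h' : ∑ σ : Equiv.Perm (Fin n), Polynomial.C ((χ σ : Fˣ) : F) * ∏ i, ev (X (i, σ i))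
      = Polynomial.C c := by
    have := congrArg (aeval y) h
    rw [← AlgHom.comp_apply, map_sum] at this
    simp only [map_mul, map_prod] at this
    convert this using 1
    · refine Finset.sum_congr rfl fun σ _ => ?_
      congr 1
      rw [← MvPolynomial.algebraMap_eq, AlgHom.commutes]; rfl
    · rw [← MvPolynomial.algebraMap_eq, AlgHom.commutes]; rfl
  have h'' := congrArg (fun p => Polynomial.coeff p (n + R.card + S.card)) h'
  simp only [Polynomial.finsetSum_coeff, Polynomial.coeff_C_mul] at h''
  rw [Polynomial.coeff_C, if_neg (by omega), Finset.sum_eq_single σ0] at h''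
  · have : ∏ i, ev (X (i, σ0 i)) = Polynomial.X ^ (n + R.card + S.card) := by
      rw [← hb σ0, ← Finset.prod_pow_eq_pow_sum]
      refine Finset.prod_congr rfl fun i _ => ?_
      rw [hev1 _ (hmem _ (fun hq => hσ0 i hq.1 hq.2))]
      simp [y]
    rw [this] at h''
    simp at h''
  · intro σ _ hσ
    by_cases hk : ∃ i, i ∈ R ∧ σ i ∈ S
    · obtain ⟨i, hi1, hi2⟩ := hk
      rw [Polynomial.coeff_eq_zero_of_natDegree_lt, mul_zero]
      refine (Polynomial.natDegree_prod_le _ _).trans_lt ?_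
      rw [← hb σ]
      refine Finset.sum_lt_sum (fun j _ => hev3 _) ⟨i, Finset.mem_univ i, ?_⟩
      refine (hev2 _).trans_lt ?_
      simp [b, hi1, hi2]
    · push Not at hk
      obtain ⟨i, hi⟩ : ∃ i, σ i ≠ σ0 i := by
        by_contra! hh; exact hσ (Equiv.ext hh)
      rw [Finset.prod_eq_zero (Finset.mem_univ i), Polynomial.coeff_zero, mul_zero]
      rw [hev1 _ (hmem _ (fun hq => hk i hq.1 hq.2))]
      simp [y, hi]
  · simp

theorem statement12 {F : Type*} [Field F] [CharZero F] {n m : ℕ} (hn : 1 ≤ n)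
    (χ : Equiv.Perm (Fin n) →* Fˣ)
    (T : Fin m → MvPolynomial (Fin n × Fin n) F)
    (hT : ∀ i, ∃ (d : ℕ) (ℓ : Fin d → MvPolynomial (Fin n × Fin n) F),
      (∀ j, (ℓ j).totalDegree ≤ 1) ∧ T i = ∏ j, ℓ j)
    (C : MvPolynomial (Fin m) F)
    (hImm : ∑ σ : Equiv.Perm (Fin n),
        MvPolynomial.C ((χ σ : Fˣ) : F) *
          ∏ i : Fin n, (X (i, σ i) : MvPolynomial (Fin n × Fin n) F) =
      aeval T C) :
    n - 1 ≤ 2 * trdegFam F T := by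
  obtain ⟨P, -, hPc, φ, hφ1, hφ2, hφ3⟩ := main_restrict (trdegFam F T) ∅ T
    (fun i => by
      obtain ⟨d, l, hl, h⟩ := hT i
      exact ⟨d, l, fun j => affSub_of_totalDegree _ (hl j), h⟩)
    (fun S hS => le_csSup ⟨m, by
      rintro _ ⟨S, rfl, -⟩
      simpa using Finset.card_le_univ S⟩ ⟨S, rfl, hS⟩)
  by_contra hlt
  rw [Finset.card_empty] at hPc
  choose c hc using hφ3
  refine imm_not_const hn χ P (by omega) φ hφ1 hφ2 (aeval c C) ?_
  rw [hImm, MvPolynomial.comp_aeval_apply]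
  have : (fun i => φ (T i)) = fun i => algebraMap F (MvPolynomial (Fin n × Fin n) F) (c i) :=
    funext hc
  rw [this]
  exact MvPolynomial.aeval_algebraMap_apply (B := MvPolynomial (Fin n × Fin n) F) c C
end

section
/- Let F be a field of characteristic zero and let f_1, …, f_s, g_1, …, g_t ∈ F[x_1, …, x_N] be such that the combined family {f_1, …, f_s, g_1, …, g_t} is algebraically dependent over F while {g_1, …, g_t} is algebraically independent over F. Let S be a set of the variables with |S| ≥ s + t. Then there exist a set V of s + t variables, an integer ρ with 1 ≤ ρ ≤ binom(s+t, t), nonzero constants c_1, …, c_ρ ∈ F, polynomials F_1, …, F_ρ that are pairwise distinct s×s minors of the Jacobian of (f_1, …, f_s) with respect to the variables in V ∩ S, and polynomials G_1, …, G_ρ that are pairwise distinct t×t minors of the Jacobian of (g_1, …, g_t) with respect to the variables in V, such that Σ_{i=1}^{ρ} c_i · F_i · G_i = 0 and not all of G_1, …, G_ρ are zero. -/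
open MvPolynomial

lemma aux_laplace {R : Type*} [CommRing R] {s t : ℕ}
    (M : Matrix (Fin s ⊕ Fin t) (Fin s ⊕ Fin t) R) :
    M.det = ∑ q : Equiv.Perm.ModSumCongr (Fin s) (Fin t),
      ((Equiv.Perm.sign q.out : ℤ) : R) *
        Matrix.det (Matrix.of fun a b : Fin s => M (Sum.inl a) (q.out (Sum.inl b))) *
        Matrix.det (Matrix.of fun a b : Fin t => M (Sum.inr a) (q.out (Sum.inr b))) := by
  classical
  let a : MultilinearMap R (fun _ : Fin s => (Fin s ⊕ Fin t → R)) R :=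
    (MultilinearMap.mkPiAlgebra R (Fin s) R).compLinearMap (fun i => LinearMap.proj (Sum.inl i))
  let b : MultilinearMap R (fun _ : Fin t => (Fin s ⊕ Fin t → R)) R :=
    (MultilinearMap.mkPiAlgebra R (Fin t) R).compLinearMap (fun i => LinearMap.proj (Sum.inr i))
  have h := congrArg (fun x => LinearMap.mul' R R (x (fun j i => M i j)))
    (MultilinearMap.domCoprod_alternization a b)
  have ha : ∀ w, MultilinearMap.alternatization a w
      = Matrix.det (Matrix.of fun i j : Fin s => w j (Sum.inl i)) := by
    intro w
    rw [← Matrix.det_transpose, Matrix.det_apply]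
    simp [MultilinearMap.alternatization_apply, a, MultilinearMap.domDomCongr_apply]
  have hb : ∀ w, MultilinearMap.alternatization b w
      = Matrix.det (Matrix.of fun i j : Fin t => w j (Sum.inr i)) := by
    intro w
    rw [← Matrix.det_transpose, Matrix.det_apply]
    simp [MultilinearMap.alternatization_apply, b, MultilinearMap.domDomCongr_apply]
  have hl : LinearMap.mul' R R (MultilinearMap.alternatization (MultilinearMap.domCoprod a b)
      (fun j i => M i j)) = M.det := by
    rw [← Matrix.det_transpose, Matrix.det_apply]
    simp [MultilinearMap.alternatization_apply, a, b, MultilinearMap.domDomCongr_apply,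
      map_sum, Units.smul_def, -zsmul_eq_mul, map_zsmul]
  rw [← hl]
  refine h.trans ?_
  simp only [AlternatingMap.domCoprod_apply, _root_.sum_apply, map_sum]
  refine Finset.sum_congr rfl fun q _ => ?_
  have hq : q = Quotient.mk'' q.out := (Quotient.out_eq' q).symm
  conv_lhs => rw [hq]
  rw [AlternatingMap.domCoprod.summand_mk'']
  rw [Units.smul_def]
  change LinearMap.mul' R R ((Equiv.Perm.sign q.out : ℤ) •
    ((MultilinearMap.alternatization a (fun i j => M j (q.out (Sum.inl i)))) ⊗ₜ[R]
      (MultilinearMap.alternatization b (fun i j => M j (q.out (Sum.inr i)))))) = _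
  rw [map_zsmul, ha, hb]
  simp [mul_assoc]

lemma aux_chain {F P : Type*} [Field F] [CommRing P] [Algebra F P] {ι : Type*} [Fintype ι]
    (D : Derivation F P P) (h : ι → P) (p : MvPolynomial ι F) :
    D (aeval h p) = ∑ i, aeval h (pderiv i p) * D (h i) := by
  classical
  induction p using MvPolynomial.induction_on with
  | C a => simp
  | add p q hp hq => simp [hp, hq, add_mul, Finset.sum_add_distrib]
  | mul_X p j hp =>
    simp only [map_mul, aeval_X, Derivation.leibniz, hp, smul_eq_mul, map_add, add_mul,
      Finset.sum_add_distrib, pderiv_X, Finset.mul_sum]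
    congr 1
    · rw [Finset.sum_eq_single j]
      · simp
      · intro b _ hb; simp [hb]
      · simp
    · exact Finset.sum_congr rfl fun i _ => by ring

lemma aux_totalDegree {F ι : Type*} [Field F] (p : MvPolynomial ι F) (i : ι)
    (hp : pderiv i p ≠ 0) : (pderiv i p).totalDegree < p.totalDegree := by
  classical
  have key : ∀ m ∈ (pderiv i p).support, (m.sum fun _ e => e) + 1 ≤ p.totalDegree := by
    intro m hm
    rw [mem_support_iff, coeff_pderiv] at hm
    have : m + Finsupp.single i 1 ∈ p.support := by
      rw [mem_support_iff]; exact left_ne_zero_of_mul hm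
    have h2 := le_totalDegree this
    rw [Finsupp.sum_add_index' (by simp) (by simp)] at h2
    simpa using h2
  obtain ⟨m, hm⟩ := support_nonempty.mpr hp
  have := key m hm
  rw [totalDegree, Finset.sup_lt_iff (by simp; omega)]
  intro m hm
  have := key m hm
  omega

lemma aux_pderiv_zero {F ι : Type*} [Field F] [CharZero F] (p : MvPolynomial ι F)
    (h : ∀ i, pderiv i p = 0) : p = C (coeff 0 p) := by
  classical
  ext m
  rw [coeff_C]
  split_ifs with hm
  · rw [hm]
  · obtain ⟨i, hi⟩ : ∃ i, m i ≠ 0 := by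
      by_contra! hc
      exact hm (by ext i; simp [hc i])
    have h1 := coeff_pderiv (i := i) p (m - Finsupp.single i 1)
    rw [h i, coeff_zero, tsub_add_cancel_of_le (by simpa [Nat.one_le_iff_ne_zero] using hi)] at h1
    have h2 := mul_eq_zero.mp h1.symm
    rcases h2 with h2 | h2
    · exact h2
    · exfalso
      norm_cast at h2

lemma aux_dep {F : Type*} [Field F] [CharZero F] {N : ℕ} {ι : Type*} [Fintype ι] [DecidableEq ι]
    (h : ι → MvPolynomial (Fin N) F) (hdep : ¬ AlgebraicIndependent F h) (v : ι → Fin N) :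
    Matrix.det (Matrix.of fun a b : ι => pderiv (v b) (h a)) = 0 := by
  classical
  rw [algebraicIndependent_iff] at hdep
  push Not at hdep
  obtain ⟨p, hp, hp0⟩ := hdep
  induction hn : p.totalDegree using Nat.strong_induction_on generalizing p with
  | _ n ih =>
  by_cases hall : ∀ i, aeval h (pderiv i p) = 0
  · by_cases hz : ∀ i, pderiv i p = 0
    · have := aux_pderiv_zero p hz
      exfalso
      rw [this] at hp
      simp at hp
      apply hp0
      rw [this, hp, C_0]
    · push Not at hz
      obtain ⟨i, hi⟩ := hz
      exact ih _ (hn ▸ aux_totalDegree p i hi) _ (hall i) hi rfl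
  · rw [← Matrix.exists_vecMul_eq_zero_iff]
    refine ⟨fun i => aeval h (pderiv i p), fun hc => hall fun i => congrFun hc i, ?_⟩
    ext1 j
    have := aux_chain (pderiv (v j)) h p
    rw [hp, map_zero] at this
    simp only [Matrix.vecMul, dotProduct, Matrix.of_apply, Pi.zero_apply]
    exact this.symm

lemma aux_der {F P : Type*} [Field F] [CharZero F] [CommRing P] [IsDomain P] [Algebra F P]
    (B : Set P) (hB : Algebra.IsAlgebraic (Algebra.adjoin F B) P)
    (D : Derivation F P P) (hD : ∀ b ∈ B, D b = 0) (x : P) : D x = 0 := by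
  classical
  have h0 : ∀ a ∈ Algebra.adjoin F B, D a = 0 := fun a ha =>
    Derivation.eqOn_adjoin (D1 := D) (D2 := 0) (fun b hb => by simpa using hD b hb) ha
  let L : P →ₗ[Algebra.adjoin F B] P :=
    { toFun := D
      map_add' := fun a b => by simp
      map_smul' := fun a b => by
        simp [Algebra.smul_def, Subalgebra.algebraMap_eq, h0 a.1 a.2] }
  let D' : Derivation (Algebra.adjoin F B) P P := Derivation.mk' L (fun a b => D.leibniz a b)
  have hD' : D' x = D x := rfl
  have : CharZero P := charZero_of_injective_algebraMap (algebraMap F P).injective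
  have : CharZero (Algebra.adjoin F B) :=
    charZero_of_injective_algebraMap (algebraMap F (Algebra.adjoin F B)).injective
  obtain ⟨p, hp0, hp⟩ := hB.isAlgebraic x
  induction hn : p.natDegree using Nat.strong_induction_on generalizing p with
  | _ n ih =>
  have h1 := D'.map_aeval p x
  rw [hp, map_zero, smul_eq_mul] at h1
  rcases mul_eq_zero.mp h1.symm with h2 | h2
  · by_cases hd : p.natDegree = 0
    · exfalso
      rw [Polynomial.eq_C_of_natDegree_eq_zero hd] at hp hp0
      simp at hp hp0
      exact hp0 hp
    · exact ih _ (hn ▸ Polynomial.natDegree_derivative_lt hd) _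
        (fun hc => hd (Polynomial.derivative_eq_zero.mp hc)) h2 rfl
  · exact h2

lemma aux_ind {F : Type*} [Field F] [CharZero F] {N t : ℕ}
    (g : Fin t → MvPolynomial (Fin N) F) (hind : AlgebraicIndependent F g) :
    ∃ c : Fin t ↪ Fin N,
      Matrix.det (Matrix.of fun a b : Fin t => pderiv (c b) (g a)) ≠ 0 := by
  classical
  have hX : IsTranscendenceBasis F (X : Fin N → MvPolynomial (Fin N) F) :=
    IsTranscendenceBasis.mvPolynomial (Fin N) F
  have : Algebra.IsAlgebraic (Algebra.adjoin F
      (Set.range g ∪ Set.range (X : Fin N → MvPolynomial (Fin N) F)))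
      (MvPolynomial (Fin N) F) := by
    have : Algebra.adjoin F
      (Set.range g ∪ Set.range (X : Fin N → MvPolynomial (Fin N) F)) = ⊤ := by
      rw [eq_top_iff, ← MvPolynomial.adjoin_range_X]
      exact Algebra.adjoin_mono Set.subset_union_right
    rw [this]
    refine ⟨fun x => isAlgebraic_algebraMap (⟨x, trivial⟩ : (⊤ : Subalgebra F _))⟩
  obtain ⟨B, hgB, hBu, hB⟩ := exists_isTranscendenceBasis_between (R := F) (Set.range g)
    (Set.range g ∪ Set.range (X : Fin N → MvPolynomial (Fin N) F)) Set.subset_union_left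
    (AlgebraicIndependent.coe_range hind)
  have hcard := hX.lift_cardinalMk_eq hB
  have hNB : N = B.ncard := by
    have := congrArg Cardinal.toNat hcard
    rw [← Nat.card_coe_set_eq]
    simpa [Nat.card] using this
  let A : Finset (Fin N) := Finset.univ.filter fun j => (X j : MvPolynomial (Fin N) F) ∈ B ∧
    X j ∉ Set.range g
  have hBeq : B = Set.range g ∪ (X '' (A : Set (Fin N))) := by
    ext y
    constructor
    · intro hy
      by_cases hg : y ∈ Set.range g
      · exact Or.inl hg
      · rcases hBu hy with h | ⟨j, rfl⟩
        · exact Or.inl h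
        · exact Or.inr ⟨j, by simpa [A] using ⟨hy, by simpa using hg⟩, rfl⟩
    · rintro (h | ⟨j, hj, rfl⟩)
      · exact hgB h
      · have : j ∈ A := hj
        simp only [A, Finset.mem_filter] at this
        exact this.2.1
  have hdisj : Disjoint (Set.range g) (X '' (A : Set (Fin N))) := by
    rw [Set.disjoint_left]
    rintro _ hy ⟨j, hj, rfl⟩
    have : j ∈ A := hj
    simp only [A, Finset.mem_filter] at this
    exact this.2.2 hy
  have hc : N = t + A.card := by
    refine hNB.trans ?_
    rw [hBeq, Set.ncard_union_eq hdisj (Set.finite_range g) ((Finset.finite_toSet A).image _),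
      Set.ncard_image_of_injective _ (MvPolynomial.X_injective), Set.ncard_coe_finset,
      ← Set.image_univ, Set.ncard_image_of_injective _ hind.injective, Set.ncard_univ]
    simp
  have hAc : Aᶜ.card = t := by
    rw [Finset.card_compl, Fintype.card_fin]; omega
  let e := Aᶜ.orderEmbOfFin hAc
  refine ⟨e.toEmbedding, ?_⟩
  intro hdet
  obtain ⟨u, hu0, hu⟩ := Matrix.exists_mulVec_eq_zero_iff.mpr hdet
  let D : Derivation F (MvPolynomial (Fin N) F) (MvPolynomial (Fin N) F) :=
    ∑ b, u b • pderiv (e b)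
  have hD : ∀ x, D x = ∑ b, u b * pderiv (e b) x := by
    intro x
    simp only [D]
    rw [← Derivation.coeFnAddMonoidHom_apply, map_sum]
    simp
  have halg : Algebra.IsAlgebraic (Algebra.adjoin F B) (MvPolynomial (Fin N) F) := by
    have h1 := hB.isAlgebraic
    have h2 : Set.range (Subtype.val : B → MvPolynomial (Fin N) F) = B := Subtype.range_coe
    rwa [h2] at h1
  have hz : ∀ x, D x = 0 := by
    refine aux_der B halg D ?_
    intro y hy
    rw [hBeq] at hy
    rw [hD]
    rcases hy with ⟨a, rfl⟩ | ⟨j, hj, rfl⟩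
    · have := congrFun hu a
      simp only [Matrix.mulVec, dotProduct, Matrix.of_apply, Pi.zero_apply] at this
      rw [← this]
      exact Finset.sum_congr rfl fun b _ => mul_comm _ _
    · refine Finset.sum_eq_zero fun b _ => ?_
      have hb : e b ∈ Aᶜ := Finset.orderEmbOfFin_mem _ _ _
      rw [pderiv_X_of_ne, mul_zero]
      rintro rfl
      exact (Finset.mem_compl.mp hb) hj
  apply hu0
  ext1 b
  have := hz (X (e b))
  rw [hD, Finset.sum_eq_single b] at this
  · simpa using this
  · intro b' _ hb
    rw [pderiv_X_of_ne, mul_zero]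
    exact fun h => hb (e.injective h.symm)
  · simp

lemma aux_coset {s t : ℕ} (q q' : Equiv.Perm.ModSumCongr (Fin s) (Fin t))
    (h : ∀ b, ∃ b', q.out (Sum.inl b) = q'.out (Sum.inl b')) : q = q' := by
  have h1 : (q'.out⁻¹ * q.out) ∈ (Equiv.Perm.sumCongrHom (Fin s) (Fin t)).range := by
    apply Equiv.Perm.mem_sumCongrHom_range_of_perm_mapsTo_inl
    rintro _ ⟨b, rfl⟩
    obtain ⟨b', hb⟩ := h b
    exact ⟨b', by simp [hb]⟩
  have := QuotientGroup.eq.mpr h1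
  rw [← Quotient.out_eq' q, ← Quotient.out_eq' q']
  exact this.symm

lemma aux_coset' {s t : ℕ} (q q' : Equiv.Perm.ModSumCongr (Fin s) (Fin t))
    (h : ∀ b, ∃ b', q.out (Sum.inr b) = q'.out (Sum.inr b')) : q = q' := by
  apply aux_coset
  have h1 : Set.MapsTo (q'.out⁻¹ * q.out) (Set.range Sum.inl) (Set.range Sum.inl) := by
    rw [Equiv.Perm.perm_mapsTo_inl_iff_mapsTo_inr]
    rintro _ ⟨b, rfl⟩
    obtain ⟨b', hb⟩ := h b
    exact ⟨b', by simp [hb]⟩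
  intro b
  obtain ⟨b', hb⟩ := h1 ⟨b, rfl⟩
  refine ⟨b', ?_⟩
  rw [hb]
  simp

theorem statement13 {F : Type*} [Field F] [CharZero F] {N s t : ℕ}
    (f : Fin s → MvPolynomial (Fin N) F) (g : Fin t → MvPolynomial (Fin N) F)
    (hdep : ¬ AlgebraicIndependent F (Sum.elim f g))
    (hind : AlgebraicIndependent F g)
    (S : Finset (Fin N)) (hS : s + t ≤ S.card) :
    ∃ (V : Finset (Fin N)) (ρ : ℕ) (c : Fin ρ → F)
      (colF : Fin ρ → (Fin s ↪ Fin N)) (colG : Fin ρ → (Fin t ↪ Fin N)),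
      V.card = s + t ∧ 1 ≤ ρ ∧ ρ ≤ (s + t).choose t ∧
      (∀ i, c i ≠ 0) ∧
      (∀ i a, colF i a ∈ V ∩ S) ∧
      (∀ i a, colG i a ∈ V) ∧
      (∀ i i', i ≠ i' →
        Finset.image (colF i) Finset.univ ≠ Finset.image (colF i') Finset.univ) ∧
      (∀ i i', i ≠ i' →
        Finset.image (colG i) Finset.univ ≠ Finset.image (colG i') Finset.univ) ∧
      (∑ i : Fin ρ, MvPolynomial.C (c i) *
          Matrix.det (Matrix.of fun a b : Fin s => pderiv (colF i b) (f a)) *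
          Matrix.det (Matrix.of fun a b : Fin t => pderiv (colG i b) (g a)) = 0) ∧
      (∃ i : Fin ρ,
        Matrix.det (Matrix.of fun a b : Fin t => pderiv (colG i b) (g a)) ≠ 0) := by
  classical
  let G : (Fin t ↪ Fin N) → MvPolynomial (Fin N) F := fun c =>
    Matrix.det (Matrix.of fun a b : Fin t => pderiv (c b) (g a))
  let w : (Fin t ↪ Fin N) → ℕ := fun c => (Finset.univ.map c ∩ S).card
  obtain ⟨c₀, hc₀⟩ := aux_ind g hind
  obtain ⟨T, hT, hTmax⟩ := Finset.exists_max_image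
    (Finset.univ.filter fun c => G c ≠ 0) w ⟨c₀, by simpa [G] using hc₀⟩
  have hGT : G T ≠ 0 := (Finset.mem_filter.mp hT).2
  have hmax : ∀ c, G c ≠ 0 → w c ≤ w T := fun c hc => hTmax c (by simpa using hc)
  have hST : s ≤ (S \ Finset.univ.map T).card := by
    have h1 := Finset.le_card_sdiff (Finset.univ.map T) S
    rw [Finset.card_map, Finset.card_univ, Fintype.card_fin] at h1
    omega
  obtain ⟨A, hAS, hAc⟩ := Finset.exists_subset_card_eq hST
  let eA : Fin s ↪ Fin N := (A.orderEmbOfFin hAc).toEmbedding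
  have heA : ∀ b, eA b ∈ S ∧ ∀ a, T a ≠ eA b := by
    intro b
    have h1 : eA b ∈ A := Finset.orderEmbOfFin_mem _ _ _
    have h2 := Finset.mem_sdiff.mp (hAS h1)
    exact ⟨h2.1, by simpa using h2.2⟩
  let e : Fin s ⊕ Fin t ↪ Fin N := ⟨Sum.elim eA T, by
    rw [Sum.elim_injective]
    exact ⟨eA.injective, T.injective, fun a b h => (heA a).2 b h.symm⟩⟩
  let V : Finset (Fin N) := Finset.univ.map e
  have hV : V.card = s + t := by simp [V]
  have hVS : V \ S ⊆ Finset.univ.map T \ S := by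
    intro x hx
    obtain ⟨hx1, hx2⟩ := Finset.mem_sdiff.mp hx
    refine Finset.mem_sdiff.mpr ⟨?_, hx2⟩
    obtain ⟨j, -, rfl⟩ := Finset.mem_map.mp hx1
    rcases j with j | j
    · exact absurd (heA j).1 hx2
    · exact Finset.mem_map.mpr ⟨j, Finset.mem_univ _, rfl⟩
  let cF : Equiv.Perm.ModSumCongr (Fin s) (Fin t) → (Fin s ↪ Fin N) := fun q =>
    (Function.Embedding.inl.trans q.out.toEmbedding).trans e
  let cG : Equiv.Perm.ModSumCongr (Fin s) (Fin t) → (Fin t ↪ Fin N) := fun q =>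
    (Function.Embedding.inr.trans q.out.toEmbedding).trans e
  have hcF : ∀ q b, cF q b = e (q.out (Sum.inl b)) := fun _ _ => rfl
  have hcG : ∀ q b, cG q b = e (q.out (Sum.inr b)) := fun _ _ => rfl
  have hcGV : ∀ q b, cG q b ∈ V := fun q b => Finset.mem_map.mpr ⟨_, Finset.mem_univ _, rfl⟩
  have hcFV : ∀ q b, cF q b ∈ V := fun q b => Finset.mem_map.mpr ⟨_, Finset.mem_univ _, rfl⟩
  have hinjF : ∀ q q', Finset.image (cF q) Finset.univ = Finset.image (cF q') Finset.univ →
      q = q' := by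
    intro q q' h
    apply aux_coset
    intro b
    have : cF q b ∈ Finset.image (cF q') Finset.univ := h ▸ Finset.mem_image_of_mem _ (Finset.mem_univ _)
    obtain ⟨b', -, hb'⟩ := Finset.mem_image.mp this
    exact ⟨b', (e.injective hb').symm⟩
  have hinjG : ∀ q q', Finset.image (cG q) Finset.univ = Finset.image (cG q') Finset.univ →
      q = q' := by
    intro q q' h
    apply aux_coset'
    intro b
    have : cG q b ∈ Finset.image (cG q') Finset.univ := h ▸ Finset.mem_image_of_mem _ (Finset.mem_univ _)
    obtain ⟨b', -, hb'⟩ := Finset.mem_image.mp this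
    exact ⟨b', (e.injective hb').symm⟩
  have hFS : ∀ q, G (cG q) ≠ 0 → ∀ b, cF q b ∈ S := by
    intro q hq b
    by_contra hb
    have h1 := hmax _ hq
    have h2 : Finset.univ.map (cG q) \ S ⊆ (V \ S).erase (cF q b) := by
      intro x hx
      obtain ⟨hx1, hx2⟩ := Finset.mem_sdiff.mp hx
      obtain ⟨j, -, rfl⟩ := Finset.mem_map.mp hx1
      refine Finset.mem_erase.mpr ⟨?_, Finset.mem_sdiff.mpr ⟨hcGV q j, hx2⟩⟩
      intro h
      rw [hcG, hcF] at h
      have := q.out.injective (e.injective h)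
      cases this
    have h3 := Finset.card_le_card h2
    have h4 : cF q b ∈ V \ S := Finset.mem_sdiff.mpr ⟨hcFV q b, hb⟩
    have h5 := Finset.card_erase_lt_of_mem h4
    have h6 := Finset.card_le_card hVS
    have h7 := Finset.card_sdiff_add_card_inter (Finset.univ.map (cG q)) S
    have h8 := Finset.card_sdiff_add_card_inter (Finset.univ.map T) S
    rw [Finset.card_map, Finset.card_univ, Fintype.card_fin] at h7 h8
    simp only [w] at h1
    omega
  let Q : Finset (Equiv.Perm.ModSumCongr (Fin s) (Fin t)) :=
    Finset.univ.filter fun q => G (cG q) ≠ 0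
  have hQ : ∀ q ∈ Q, G (cG q) ≠ 0 := fun q hq => (Finset.mem_filter.mp hq).2
  have hQne : Q.Nonempty := by
    let q₀ : Equiv.Perm.ModSumCongr (Fin s) (Fin t) := Quotient.mk'' 1
    refine ⟨q₀, Finset.mem_filter.mpr ⟨Finset.mem_univ _, ?_⟩⟩
    have h1 : (Quotient.mk'' q₀.out : Equiv.Perm.ModSumCongr (Fin s) (Fin t)) = Quotient.mk'' 1 :=
      Quotient.out_eq' q₀
    have h2 := QuotientGroup.eq.mp h1.symm
    rw [inv_one, one_mul] at h2
    obtain ⟨⟨sl, sr⟩, h3⟩ := h2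
    have h4 : ∀ b, cG q₀ b = T (sr b) := by
      intro b
      rw [hcG, ← h3]
      simp [e]
    have h5 : G (cG q₀) = Equiv.Perm.sign sr * G T := by
      simp only [G, h4]
      rw [← Matrix.det_permute']
      rfl
    rw [h5]
    refine mul_ne_zero ?_ hGT
    rcases Int.units_eq_one_or (Equiv.Perm.sign sr) with h | h <;> simp [h]
  have hQc : Q.card ≤ (s + t).choose t := by
    rw [← hV, ← Finset.card_powersetCard]
    refine Finset.card_le_card_of_injOn (fun q => Finset.image (cG q) Finset.univ) ?_
      (fun q _ q' _ h => hinjG q q' h)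
    intro q _
    refine Finset.mem_powersetCard.mpr ⟨?_, ?_⟩
    · intro x hx
      obtain ⟨b, -, rfl⟩ := Finset.mem_image.mp hx
      exact hcGV q b
    · rw [Finset.card_image_of_injective _ (cG q).injective]; simp
  have hsum : ∑ q ∈ Q, MvPolynomial.C ((Equiv.Perm.sign q.out : ℤ) : F) *
      Matrix.det (Matrix.of fun a b : Fin s => pderiv (cF q b) (f a)) * G (cG q) = 0 := by
    have h0 := aux_dep (Sum.elim f g) hdep e
    rw [aux_laplace] at h0
    rw [← h0]
    rw [Finset.sum_filter]
    refine Finset.sum_congr rfl fun q _ => ?_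
    have h1 : Matrix.det (Matrix.of fun a b : Fin t => Matrix.of
        (fun a b => pderiv (e b) (Sum.elim f g a)) (Sum.inr a) (q.out (Sum.inr b))) = G (cG q) := rfl
    rw [h1]
    split_ifs with h
    · simp [hcF]
    · rw [not_not.mp h, mul_zero]
  let E := Q.equivFin.symm
  refine ⟨V, Q.card, fun i => ((Equiv.Perm.sign (E i).1.out : ℤ) : F), fun i => cF (E i).1,
    fun i => cG (E i).1, hV, hQne.card_pos, hQc, ?_, ?_, fun i a => hcGV _ a, ?_, ?_, ?_, ?_⟩
  · intro i
    rcases Int.units_eq_one_or (Equiv.Perm.sign (E i).1.out) with h | h <;> simp [h]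
  · intro i a
    exact Finset.mem_inter.mpr ⟨hcFV _ a, hFS _ (hQ _ (E i).2) a⟩
  · intro i i' hii h
    exact hii (E.injective (Subtype.ext (hinjF _ _ h)))
  · intro i i' hii h
    exact hii (E.injective (Subtype.ext (hinjG _ _ h)))
  · rw [← Finset.sum_coe_sort] at hsum
    rw [← hsum]
    exact Equiv.sum_comp E (fun q : Q => MvPolynomial.C ((Equiv.Perm.sign q.1.out : ℤ) : F) *
      Matrix.det (Matrix.of fun a b : Fin s => pderiv (cF q.1 b) (f a)) * G (cG q.1))
  · exact ⟨⟨0, hQne.card_pos⟩, hQ _ (E _).2⟩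
end

section
/- There exists a constant c > 0 such that the following holds for all integers n ≥ 1 and k ≥ 1. Let F be a field of characteristic zero, χ : S_n → F^× a group homomorphism, and Imm_n = Σ_{σ ∈ S_n} χ(σ) ∏_{i=1}^{n} x_{i,σ(i)} ∈ F[x_{ij}]. Suppose Imm_n = Σ_{i=1}^{m} ∏_{j=1}^{d_i} P_{ij}^{e_{ij}}, where each P_{ij} ∈ F[x_{ij}], each e_{ij} ≥ 1, and every variable x_{uv} appears in at most k of the polynomials P_{ij}. Let s = m + Σ_{i,j} sparsity(P_{ij}). Then s ≥ 2^{c·n/k²}. -/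
open MvPolynomial

namespace Occ
open Finset

noncomputable section

set_option linter.unusedSectionVars false

variable {α : Type} [Fintype α] [DecidableEq α] {F : Type} [Field F]

abbrev TT (z : α) (R : Finset α) (p : Equiv.Perm α) : Finset (Equiv.Perm α) :=
  Finset.univ.filter (fun σ => ∀ i, i ∉ insert z R → σ i = p i)

abbrev CC (z : α) (R : Finset α) (p : Equiv.Perm α) : Finset α := (insert z R).image p

def Rel (z : α) (R : Finset α) (p : Equiv.Perm α) (χ : Equiv.Perm α → F)
    (c : α → MvPolynomial (α × α) F) : Prop :=
  ∑ σ ∈ TT z R p, C (χ σ) * c (σ z) * ∏ i ∈ R, (X (i, σ i) : MvPolynomial (α × α) F) = 0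

def wt (r : α) (w : α → ℤ) : α × α → ℤ := fun v => if v.1 = r then w v.2 else 0

abbrev comp (r : α) (w : α → ℤ) (W : ℤ) :
    MvPolynomial (α × α) F →ₗ[F] MvPolynomial (α × α) F :=
  weightedHomogeneousComponent (wt r w) W

lemma comp_mul_monomial (r : α) (w : α → ℤ) (W : ℤ) (p : MvPolynomial (α × α) F)
    (s : α × α →₀ ℕ) :
    comp r w W (p * monomial s 1) =
      comp r w (W - Finsupp.weight (wt r w) s) p * monomial s 1 := by
  classical
  ext m
  rw [coeff_weightedHomogeneousComponent, coeff_mul_monomial', coeff_mul_monomial',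
    coeff_weightedHomogeneousComponent]
  by_cases h : s ≤ m
  · obtain ⟨t, rfl⟩ := exists_add_of_le h
    simp only [h, if_true, map_add, add_tsub_cancel_left, mul_one]
    congr 1
    apply propext
    constructor <;> intro h <;> linarith
  · simp [h]

lemma prod_X_eq (R : Finset α) (σ : Equiv.Perm α) :
    ∏ i ∈ R, (X (i, σ i) : MvPolynomial (α × α) F) =
      monomial (∑ i ∈ R, Finsupp.single (i, σ i) 1) 1 := by
  rw [monomial_sum_one]; rfl

lemma weight_prod (R : Finset α) (σ : Equiv.Perm α) (r : α) (hr : r ∈ R) (w : α → ℤ) :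
    Finsupp.weight (wt r w) (∑ i ∈ R, Finsupp.single (i, σ i) 1) = w (σ r) := by
  rw [map_sum]
  simp [Finsupp.weight_apply, wt, hr]

lemma card_CC (z : α) (R : Finset α) (p : Equiv.Perm α) (hz : z ∉ R) :
    (CC z R p).card = R.card + 1 := by
  rw [Finset.card_image_of_injective _ p.injective, Finset.card_insert_of_notMem hz]

lemma mem_CC_of_mem_TT {z : α} {R : Finset α} {p σ : Equiv.Perm α} (h : σ ∈ TT z R p)
    {i : α} (hi : i ∈ insert z R) : σ i ∈ CC z R p := by
  simp only [TT, mem_filter, mem_univ, true_and] at h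
  by_contra hc
  apply hc
  rw [mem_image]
  refine ⟨p.symm (σ i), ?_, by simp⟩
  by_contra hn
  have := h _ hn
  simp at this
  rw [this] at hn
  exact hn hi

lemma extract (z : α) (R : Finset α) (p : Equiv.Perm α) (χ : Equiv.Perm α → F)
    (c : α → MvPolynomial (α × α) F) (hz : z ∉ R) (r : α) (hr : r ∈ R) (j : α)
    (hj : j ∈ CC z R p) (w : α → ℤ) (hw : ∀ j', j' ≠ j → w j' < w j)
    (hne : ∃ l ∈ CC z R p, c l ≠ 0) (hrel : Rel z R p χ c) :
    ∃ (p' : Equiv.Perm α) (W : ℤ), CC z (R.erase r) p' = (CC z R p).erase j ∧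
      Rel z (R.erase r) p' χ (fun l => comp r w W (c l)) ∧
      (∃ l ∈ CC z R p, comp r w W (c l) ≠ 0) ∧
      (∀ l ∈ CC z R p, ∀ m ∈ (c l).support, Finsupp.weight (wt r w) m ≤ W) := by
  classical
  have hzr : z ≠ r := by rintro rfl; exact hz hr
  -- max weight
  let U : Finset (Σ _ : α, (α × α →₀ ℕ)) := (CC z R p).sigma (fun l => (c l).support)
  have hU : U.Nonempty := by
    obtain ⟨l, hl, hcl⟩ := hne
    obtain ⟨m, hm⟩ := support_nonempty.mpr hcl
    exact ⟨⟨l, m⟩, by simp only [U, Finset.mem_sigma]; exact ⟨hl, hm⟩⟩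
  obtain ⟨⟨l0, m0⟩, hlm, hmax⟩ := Finset.exists_max_image U
    (fun q => Finsupp.weight (wt r w) q.2) hU
  simp only [U, Finset.mem_sigma] at hlm hmax
  set W := Finsupp.weight (wt r w) m0 with hW
  have hle : ∀ l ∈ CC z R p, ∀ m ∈ (c l).support, Finsupp.weight (wt r w) m ≤ W :=
    fun l hl m hm => hmax ⟨l, m⟩ ⟨hl, hm⟩
  have hbig : ∀ l ∈ CC z R p, ∀ W', W < W' → comp r w W' (c l) = 0 := by
    intro l hl W' hW'
    ext m
    rw [coeff_weightedHomogeneousComponent]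
    split_ifs with h
    · by_contra hc
      have := hle l hl m (by rw [mem_support_iff]; simpa using hc)
      omega
    · simp
  rw [mem_image] at hj
  obtain ⟨i0, hi0, rfl⟩ := hj
  refine ⟨p * Equiv.swap r i0, W, ?_, ?_, ?_, hle⟩
  · ext x
    simp only [CC, mem_image, mem_erase, mem_insert] at hi0 ⊢
    constructor
    · rintro ⟨i, hi, rfl⟩
      have hir : i ≠ r := by rcases hi with rfl | hi; exacts [hzr, hi.1]
      have hi' : i = z ∨ i ∈ R := by tauto
      refine ⟨?_, Equiv.swap r i0 i, ?_, rfl⟩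
      · simp only [Equiv.Perm.mul_apply, ne_eq, EmbeddingLike.apply_eq_iff_eq]
        intro h
        rw [Equiv.swap_apply_eq_iff] at h
        simp at h
        exact hir h
      · by_cases h : i = i0
        · subst h; simp [hr]
        · rw [Equiv.swap_apply_of_ne_of_ne hir h]; exact hi'
    · rintro ⟨hx, i, hi, rfl⟩
      have hii : i ≠ i0 := by rintro rfl; exact hx rfl
      by_cases h : i = r
      · subst h
        refine ⟨i0, ?_, by simp⟩
        rcases hi0 with h | h
        · exact Or.inl h
        · exact Or.inr ⟨fun e => hii e.symm, h⟩
      · refine ⟨i, by tauto, ?_⟩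
        simp [Equiv.swap_apply_of_ne_of_ne h hii]
  · have hT : TT z (R.erase r) (p * Equiv.swap r i0) = (TT z R p).filter (fun σ => σ r = p i0) := by
      ext σ
      simp only [TT, mem_filter, mem_univ, true_and, mem_insert, mem_erase]
      simp only [mem_insert] at hi0
      have key : ∀ i, ¬ (i = z ∨ i ∈ R) → (p * Equiv.swap r i0) i = p i := by
        intro i hi
        have h1 : i ≠ r := by rintro rfl; tauto
        have h2 : i ≠ i0 := by rintro rfl; tauto
        simp [Equiv.swap_apply_of_ne_of_ne h1 h2]
      constructor
      · intro h
        refine ⟨fun i hi => ?_, ?_⟩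
        · rw [h i (by tauto), key i hi]
        · rw [h r (by simp [Ne.symm hzr])]; simp
      · rintro ⟨h, h2⟩ i hi
        by_cases e : i = r
        · subst e; simp [h2]
        · have hi' : ¬ (i = z ∨ i ∈ R) := by tauto
          rw [h i hi', key i hi']
    unfold Rel at hrel ⊢
    rw [hT, Finset.sum_filter]
    have h1 := congrArg (comp r w (W + w (p i0))) hrel
    rw [map_sum, map_zero] at h1
    have hX : (X (r, p i0) : MvPolynomial (α × α) F) ≠ 0 := X_ne_zero _
    apply (mul_eq_zero.mp (?_ : (X (r, p i0) : MvPolynomial (α × α) F) * _ = 0)).resolve_left hX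
    refine Eq.trans ?_ h1
    rw [Finset.mul_sum]
    apply Finset.sum_congr rfl
    intro σ hσ
    rw [prod_X_eq R, comp_mul_monomial, weight_prod R σ r hr, ← prod_X_eq, (C_mul' : C (χ σ) * c (σ z) = _),
      map_smul, ← C_mul']
    split_ifs with h
    · rw [h, ← Finset.mul_prod_erase R _ hr, h, add_sub_cancel_right]
      ring
    · rw [hbig (σ z) (mem_CC_of_mem_TT hσ (by simp))]
      · simp
      · have := hw _ h
        omega
  · refine ⟨l0, hlm.1, ?_⟩
    intro h
    have := congrArg (coeff m0) h
    rw [coeff_weightedHomogeneousComponent, if_pos hW.symm, coeff_zero] at this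
    exact (mem_support_iff.mp hlm.2) this

lemma single_false (z : α) (χ : Equiv.Perm α → F) (hχ : ∀ σ, χ σ ≠ 0) : ∀ (N : ℕ)
    (R : Finset α) (p : Equiv.Perm α) (c : α → MvPolynomial (α × α) F), R.card = N → z ∉ R →
    ∀ j ∈ CC z R p, c j ≠ 0 → (∀ l ∈ CC z R p, l ≠ j → c l = 0) → Rel z R p χ c → False := by
  intro N
  induction N with
  | zero =>
    intro R p c hR hz j hj hcj hl hrel
    rw [Finset.card_eq_zero] at hR
    subst hR
    simp only [CC, insert_empty, image_singleton, mem_singleton] at hj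
    subst hj
    have hT : TT z ∅ p = {p} := by
      ext σ
      simp only [TT, mem_filter, mem_univ, true_and, mem_singleton, insert_empty]
      constructor
      · intro h
        ext i
        by_cases hi : i = z
        · subst hi
          by_contra hc
          have h2 : p.symm (σ i) ≠ i := by
            intro e; apply hc; rw [← e]; simp
            rw [e]
          have := h _ h2
          simp at this
          exact h2 this
        · exact h i hi
      · rintro rfl; simp
    unfold Rel at hrel
    rw [hT] at hrel
    simp [hχ, hcj] at hrel
  | succ N ih =>
    intro R p c hR hz j hj hcj hl hrel
    obtain ⟨r, hr⟩ : R.Nonempty := by rw [← Finset.card_pos]; omega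
    have hC := card_CC z R p hz
    obtain ⟨b, hb, hbj⟩ := Finset.exists_mem_ne (s := CC z R p) (by omega) j
    obtain ⟨p', W, h1, h2, ⟨l, hl1, hl2⟩, -⟩ := extract z R p χ c hz r hr b hb (Pi.single b 1)
      (by intro j' hj'; simp [hj']) ⟨j, hj, hcj⟩ hrel
    have hlj : l = j := by
      by_contra hc
      rw [hl l hl1 hc] at hl2
      simp at hl2
    subst hlj
    refine ih (R.erase r) p' _ (by rw [Finset.card_erase_of_mem hr]; omega) (by simp [hz]) l
      (by rw [h1]; simp [hbj.symm]; simpa using hj) hl2 ?_ h2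
    intro l' hl' hne
    rw [h1, mem_erase] at hl'
    rw [hl l' hl'.2 hne, map_zero]

lemma support_comp (r : α) (w : α → ℤ) (W : ℤ) (p : MvPolynomial (α × α) F) :
    (comp r w W p).support = p.support.filter (fun m => Finsupp.weight (wt r w) m = W) := by
  classical
  ext m
  rw [mem_support_iff, coeff_weightedHomogeneousComponent, mem_filter, mem_support_iff]
  split_ifs with h <;> simp [h]

lemma weight_lin (r : α) (u w : α → ℤ) (m : α × α →₀ ℕ) :
    Finsupp.weight (wt r (u + 2 * w)) m =
      Finsupp.weight (wt r u) m + 2 * Finsupp.weight (wt r w) m := by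
  simp only [Finsupp.weight_apply, Finsupp.sum, Finset.mul_sum]
  rw [← Finset.sum_add_distrib]
  apply Finset.sum_congr rfl
  intro x _
  unfold wt
  split_ifs <;> simp; ring

lemma weight_neg (r : α) (w : α → ℤ) (m : α × α →₀ ℕ) :
    Finsupp.weight (wt r (-w)) m = - Finsupp.weight (wt r w) m := by
  simp only [Finsupp.weight_apply, Finsupp.sum]
  rw [← Finset.sum_neg_distrib]
  apply Finset.sum_congr rfl
  intro x _
  unfold wt
  split_ifs <;> simp

open Classical in
lemma main_lower (z : α) (χ : Equiv.Perm α → F) (hχ : ∀ σ, χ σ ≠ 0) : ∀ (N : ℕ)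
    (R : Finset α) (p : Equiv.Perm α) (c : α → MvPolynomial (α × α) F), R.card = N → z ∉ R →
    (∃ l ∈ CC z R p, c l ≠ 0) → Rel z R p χ c →
    2 ^ (CC z R p).card ≤ (∑ l ∈ CC z R p, (c l).support.card) *
      2 ^ (((CC z R p).filter (fun l => c l ≠ 0)).card + 1) := by
  intro N
  induction N with
  | zero =>
    intro R p c hR hz hne hrel
    exfalso
    obtain ⟨l, hl, hcl⟩ := hne
    refine single_false z χ hχ 0 R p c hR hz l hl hcl ?_ hrel
    intro l' hl' hne
    have hC := card_CC z R p hz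
    exact absurd (Finset.card_le_one.mp (by omega) _ hl' _ hl) hne
  | succ N ih =>
    intro R p c hR hz hne hrel
    obtain ⟨r, hr⟩ : R.Nonempty := by rw [← Finset.card_pos]; omega
    have hC := card_CC z R p hz
    set Cs := CC z R p with hCs
    set L := Cs.filter (fun l => c l ≠ 0) with hL
    have hRe : (R.erase r).card = N := by rw [Finset.card_erase_of_mem hr]; omega
    have hze : z ∉ R.erase r := by simp [hz]
    -- generic consequence
    have step : ∀ (w : α → ℤ) (W : ℤ) (p' : Equiv.Perm α) (b : α), b ∈ Cs →
        CC z (R.erase r) p' = Cs.erase b →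
        Rel z (R.erase r) p' χ (fun l => comp r w W (c l)) →
        (∃ l ∈ Cs, l ≠ b ∧ comp r w W (c l) ≠ 0) →
        2 ^ Cs.card ≤ 2 * ((∑ l ∈ Cs, (comp r w W (c l)).support.card) *
          2 ^ ((L.erase b).card + 1)) := by
      intro w W p' b hb h1 h2 ⟨l, hl, hlb, hcl⟩
      have := ih (R.erase r) p' _ hRe hze ⟨l, by rw [h1]; simp [hlb, hl], hcl⟩ h2
      rw [h1, Finset.card_erase_of_mem hb] at this
      have e : 2 ^ Cs.card = 2 * 2 ^ (Cs.card - 1) := by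
        rw [← pow_succ']; congr 1; omega
      rw [e]
      apply Nat.mul_le_mul_left
      refine this.trans (Nat.mul_le_mul ?_ ?_)
      · exact Finset.sum_le_sum_of_subset (Finset.erase_subset _ _)
      · apply Nat.pow_le_pow_right (by norm_num)
        apply Nat.add_le_add_right
        apply Finset.card_le_card
        intro x hx
        simp only [mem_filter, mem_erase, hL] at hx ⊢
        refine ⟨hx.1.1, hx.1.2, ?_⟩
        intro h
        apply hx.2
        rw [h, map_zero]
    by_cases hsmall : (Cs.filter (fun l => c l = 0)).card ≤ 1
    · have hsum : L.card + (Cs.filter (fun l => c l = 0)).card = Cs.card := by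
        rw [add_comm, hL]
        exact Finset.card_filter_add_card_filter_not (s := Cs) (fun l => c l = 0)
      have : 1 ≤ ∑ l ∈ Cs, (c l).support.card := by
        obtain ⟨l, hl, hcl⟩ := hne
        refine le_trans ?_ (Finset.single_le_sum (f := fun l => (c l).support.card)
          (fun _ _ => Nat.zero_le _) hl)
        exact Finset.card_pos.mpr (support_nonempty.mpr hcl)
      calc 2 ^ Cs.card ≤ 2 ^ (L.card + 1) := Nat.pow_le_pow_right (by norm_num) (by omega)
        _ ≤ _ := Nat.le_mul_of_pos_left _ this
    · obtain ⟨a, ha, b, hb, hab⟩ := Finset.one_lt_card.mp (not_le.mp hsmall)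
      simp only [mem_filter] at ha hb
      let w : α → ℤ := fun x => if x = b then 1 else if x = a then -1 else 0
      have hwb : ∀ j', j' ≠ b → w j' < w b := by
        intro j' hj'
        simp only [w, hj', if_true, if_false]
        split_ifs <;> norm_num
      have hwa : ∀ j', j' ≠ a → (-w) j' < (-w) a := by
        intro j' hj'
        simp only [w, hj', hab, if_true, if_false, Pi.neg_apply]
        split_ifs <;> norm_num
      obtain ⟨p1, W1, h11, h12, ⟨l1, hl1, hcl1⟩, h14⟩ :=
        extract z R p χ c hz r hr b hb.1 w hwb hne hrel
      obtain ⟨p2, W2, h21, h22, ⟨l2, hl2, hcl2⟩, h24⟩ :=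
        extract z R p χ c hz r hr a ha.1 (-w) hwa hne hrel
      have hl1b : l1 ≠ b := by rintro rfl; rw [hb.2, map_zero] at hcl1; exact hcl1 rfl
      have hl2a : l2 ≠ a := by rintro rfl; rw [ha.2, map_zero] at hcl2; exact hcl2 rfl
      have hLb : (L.erase b).card ≤ L.card := Finset.card_le_card (Finset.erase_subset _ _)
      have hLa : (L.erase a).card ≤ L.card := Finset.card_le_card (Finset.erase_subset _ _)
      by_cases hW : W1 = - W2
      · -- homogeneous case
        have hhom : ∀ l ∈ Cs, ∀ m ∈ (c l).support, Finsupp.weight (wt r w) m = W1 := by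
          intro l hl m hm
          have e1 := h14 l hl m hm
          have e2 := h24 l hl m hm
          rw [weight_neg] at e2
          omega
        obtain ⟨j, hj, hcj⟩ := hne
        have hjb : j ≠ b := by rintro rfl; exact hcj hb.2
        have hja : j ≠ a := by rintro rfl; exact hcj ha.2
        let u : α → ℤ := fun x => if x = j then 1 else 0
        obtain ⟨p3, W3, h31, h32, ⟨l3, hl3, hcl3⟩, h34⟩ :=
          extract z R p χ c hz r hr j hj u
            (by intro j' hj'; simp [u, hj']) ⟨j, hj, hcj⟩ hrel
        by_cases hex : ∃ l ∈ Cs, l ≠ j ∧ comp r u W3 (c l) ≠ 0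
        · have := step u W3 p3 j hj h31 h32 hex
          have hjL : j ∈ L := by simp [hL, hj, hcj]
          rw [Finset.card_erase_of_mem hjL] at this
          have hLp : 0 < L.card := Finset.card_pos.mpr ⟨j, hjL⟩
          refine this.trans ?_
          have e : 2 ^ (L.card + 1) = 2 * 2 ^ (L.card - 1 + 1) := by
            rw [← pow_succ']; congr 1; omega
          rw [e]
          have hS : ∑ l ∈ Cs, (comp r u W3 (c l)).support.card ≤ ∑ l ∈ Cs, (c l).support.card := by
            apply Finset.sum_le_sum
            intro l _
            rw [support_comp]
            exact Finset.card_filter_le _ _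
          calc _ = (∑ l ∈ Cs, (comp r u W3 (c l)).support.card) * (2 * 2 ^ (L.card - 1 + 1)) := by
                ring
            _ ≤ _ := Nat.mul_le_mul_right _ hS
        · exfalso
          push Not at hex
          have hwb' : ∀ j', j' ≠ b → (u + 2 * w) j' < (u + 2 * w) b := by
            intro j' hj'
            simp only [u, w, hj', if_true, if_false, Pi.add_apply, Pi.mul_apply, Ne.symm hjb]
            split_ifs <;> simp
          obtain ⟨p4, W4, h41, h42, ⟨l4, hl4, hcl4⟩, h44⟩ :=
            extract z R p χ c hz r hr b hb.1 (u + 2 * w) hwb' ⟨j, hj, hcj⟩ hrel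
          obtain ⟨m3, hm3⟩ := support_nonempty.mpr hcl3
          rw [support_comp, mem_filter] at hm3
          have k1 : ∀ l ∈ Cs, comp r (u + 2 * w) W4 (c l) ≠ 0 → l = j := by
            intro l hl hcl
            obtain ⟨m4, hm4⟩ := support_nonempty.mpr hcl
            rw [support_comp, mem_filter] at hm4
            have e1 := h44 l3 hl3 m3 hm3.1
            have e2 := h34 l hl m4 hm4.1
            have e3 := hhom l hl m4 hm4.1
            have e4 := hhom l3 hl3 m3 hm3.1
            have e5 := hm4.2
            have e6 := hm3.2
            rw [weight_lin] at e1 e5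
            by_contra hlj
            have : m4 ∈ (comp r u W3 (c l)).support := by
              rw [support_comp, mem_filter]
              exact ⟨hm4.1, by omega⟩
            rw [hex l hl hlj] at this
            simp at this
          have k2 := k1 l4 hl4 hcl4
          subst k2
          refine single_false z χ hχ N (R.erase r) p4 _ hRe hze l4
            (by rw [h41]; exact mem_erase.mpr ⟨hjb, hj⟩) hcl4 ?_ h42
          intro l hl hll
          rw [h41, mem_erase] at hl
          by_contra hc
          exact hll (k1 l hl.2 hc)
      · have s1 := step w W1 p1 b hb.1 h11 h12 ⟨l1, hl1, hl1b, hcl1⟩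
        have s2 := step (-w) W2 p2 a ha.1 h21 h22 ⟨l2, hl2, hl2a, hcl2⟩
        have hdis : (∑ l ∈ Cs, (comp r w W1 (c l)).support.card) +
            (∑ l ∈ Cs, (comp r (-w) W2 (c l)).support.card) ≤ ∑ l ∈ Cs, (c l).support.card := by
          rw [← Finset.sum_add_distrib]
          apply Finset.sum_le_sum
          intro l _
          rw [support_comp, support_comp, ← Finset.card_union_of_disjoint]
          · apply Finset.card_le_card
            exact Finset.union_subset (Finset.filter_subset _ _) (Finset.filter_subset _ _)
          · rw [Finset.disjoint_filter]
            intro m _ e1 e2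
            rw [weight_neg] at e2
            omega
        have t1 : 2 ^ ((L.erase b).card + 1) ≤ 2 ^ (L.card + 1) :=
          Nat.pow_le_pow_right (by norm_num) (by omega)
        have t2 : 2 ^ ((L.erase a).card + 1) ≤ 2 ^ (L.card + 1) :=
          Nat.pow_le_pow_right (by norm_num) (by omega)
        have s1' := s1.trans (Nat.mul_le_mul_left 2 (Nat.mul_le_mul_left _ t1))
        have s2' := s2.trans (Nat.mul_le_mul_left 2 (Nat.mul_le_mul_left _ t2))
        have := Nat.mul_le_mul_right (2 ^ (L.card + 1)) hdis
        rw [add_mul] at this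
        omega

end
end Occ

namespace Occ
open Finset

noncomputable section

section kern
variable {ι κ R : Type} [Fintype ι] [Fintype κ] [DecidableEq κ] [CommRing R] [IsDomain R]

lemma kernel (V : Matrix ι κ R) (L0 : Finset κ) (h : Fintype.card ι < L0.card) :
    ∃ c : κ → R, (∀ l, l ∉ L0 → c l = 0) ∧ (∃ l ∈ L0, c l ≠ 0) ∧
      (∀ i, ∑ l, V i l * c l = 0) ∧
      ∀ l, c l = 0 ∨ ∃ (r : ℕ) (e : Fin r → ι) (f : Fin r → κ), Function.Injective e ∧
        (c l = (V.submatrix e f).det ∨ c l = - (V.submatrix e f).det) := by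
  classical
  let Q : ℕ → Prop := fun r => ∃ (e : Fin r → ι) (f : Fin r → κ), (∀ q, f q ∈ L0) ∧
    (V.submatrix e f).det ≠ 0
  have inje : ∀ (r : ℕ) (e : Fin r → ι) (f : Fin r → κ), (V.submatrix e f).det ≠ 0 →
      Function.Injective e := by
    intro r e f hd a b hab
    by_contra hne
    exact hd (Matrix.det_zero_of_row_eq hne (by ext x; simp [hab]))
  have injf : ∀ (r : ℕ) (e : Fin r → ι) (f : Fin r → κ), (V.submatrix e f).det ≠ 0 →
      Function.Injective f := by
    intro r e f hd a b hab
    by_contra hne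
    exact hd (Matrix.det_zero_of_column_eq hne (by intro x; simp [hab]))
  have hbd : ∀ r, Q r → r ≤ Fintype.card ι := by
    rintro r ⟨e, f, -, hd⟩
    simpa using Fintype.card_le_of_injective e (inje r e f hd)
  have hQ0 : Q 0 := ⟨Fin.elim0, Fin.elim0, fun q => q.elim0, by simp⟩
  let r := Nat.findGreatest Q (Fintype.card ι)
  have hr : Q r := Nat.findGreatest_spec (P := Q) (Nat.zero_le _) hQ0
  have hmax : ¬ Q (r + 1) := by
    intro hq
    have := Nat.le_findGreatest (hbd _ hq) hq
    change r + 1 ≤ r at this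
    omega
  have hrc := hbd r hr
  obtain ⟨e, f, hf, hd⟩ := hr
  have he := inje _ _ _ hd
  have hfi := injf _ _ _ hd
  obtain ⟨l0, hl0, hl0f⟩ : ∃ l0 ∈ L0, l0 ∉ univ.image f := by
    apply Finset.exists_mem_notMem_of_card_lt_card
    refine lt_of_le_of_lt Finset.card_image_le ?_
    simp only [card_univ, Fintype.card_fin]; omega
  let f' : Fin (r + 1) → κ := Fin.cons l0 f
  have hf'i : Function.Injective f' := by
    rw [Fin.cons_injective_iff]
    refine ⟨?_, hfi⟩
    simpa using hl0f
  have hf'L : ∀ q, f' q ∈ L0 := by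
    intro q
    refine Fin.cases ?_ ?_ q
    · exact hl0
    · intro q; exact hf q
  let D : Fin (r + 1) → R := fun q => (-1) ^ (q : ℕ) * (V.submatrix e (f' ∘ q.succAbove)).det
  let c : κ → R := fun l => ∑ q, if f' q = l then D q else 0
  have hc : ∀ q, c (f' q) = D q := by
    intro q
    simp only [c]
    rw [Finset.sum_eq_single q]
    · simp
    · intro b _ hb
      rw [if_neg (fun e => hb (hf'i e))]
    · simp
  have hc0 : ∀ l, (∀ q, f' q ≠ l) → c l = 0 := by
    intro l hl
    simp [c, hl]
  refine ⟨c, ?_, ⟨l0, hl0, ?_⟩, ?_, ?_⟩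
  · intro l hl
    exact hc0 l (fun q hq => hl (hq ▸ hf'L q))
  · have : c l0 = D 0 := hc 0
    rw [this]
    have : f' ∘ (0 : Fin (r+1)).succAbove = f := by
      ext q; simp [f']
    simp only [D, this]
    simpa using hd
  · intro i
    have h1 : ∑ l, V i l * c l = ∑ q, V i (f' q) * D q := by
      simp only [c, Finset.mul_sum]
      rw [Finset.sum_comm]
      apply Finset.sum_congr rfl
      intro q _
      simp
    rw [h1]
    have h2 : (V.submatrix (Fin.cons i e : Fin (r+1) → ι) f').det = 0 := by
      by_contra hne
      exact hmax ⟨_, f', hf'L, hne⟩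
    rw [Matrix.det_succ_row_zero] at h2
    rw [← h2]
    apply Finset.sum_congr rfl
    intro q _
    simp only [D, Matrix.submatrix_apply, Fin.cons_zero, Matrix.submatrix_submatrix]
    have : (Fin.cons i e : Fin (r+1) → ι) ∘ Fin.succ = e := by ext q; simp
    rw [this]
    ring
  · intro l
    by_cases hl : ∃ q, f' q = l
    · obtain ⟨q, rfl⟩ := hl
      right
      refine ⟨r, e, f' ∘ q.succAbove, he, ?_⟩
      rw [hc]
      rcases neg_one_pow_eq_or R (q : ℕ) with h | h <;> simp [D, h]
    · left
      push Not at hl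
      exact hc0 l hl

end kern

section sparse
variable {τ F : Type} [Field F]

def sp (p : MvPolynomial τ F) : ℕ := p.support.card

lemma sp_zero : sp (0 : MvPolynomial τ F) = 0 := by simp [sp]

lemma sp_monomial (m : τ →₀ ℕ) (a : F) : sp (monomial m a) ≤ 1 := by
  classical
  unfold sp
  exact (Finset.card_le_card support_monomial_subset).trans (by simp)

lemma sp_add (p q : MvPolynomial τ F) : sp (p + q) ≤ sp p + sp q := by
  classical
  exact (Finset.card_le_card support_add).trans (Finset.card_union_le _ _)

lemma sp_sum {ι : Type} (s : Finset ι) (f : ι → MvPolynomial τ F) :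
    sp (∑ i ∈ s, f i) ≤ ∑ i ∈ s, sp (f i) := by
  classical
  induction s using Finset.induction_on with
  | empty => simp [sp_zero]
  | insert a s ha ih =>
    rw [Finset.sum_insert ha, Finset.sum_insert ha]
    exact (sp_add _ _).trans (by omega)

lemma sp_mul (p q : MvPolynomial τ F) : sp (p * q) ≤ sp p * sp q := by
  classical
  exact (Finset.card_le_card (support_mul p q)).trans Finset.card_add_le

lemma sp_one : sp (1 : MvPolynomial τ F) ≤ 1 := sp_monomial 0 1

lemma sp_C (a : F) : sp (C a : MvPolynomial τ F) ≤ 1 := sp_monomial 0 a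

lemma sp_X (v : τ) : sp (X v : MvPolynomial τ F) ≤ 1 := sp_monomial _ 1

lemma sp_neg (p : MvPolynomial τ F) : sp (-p) = sp p := by
  unfold sp; rw [support_neg]

lemma sp_prod {ι : Type} (s : Finset ι) (f : ι → MvPolynomial τ F) :
    sp (∏ i ∈ s, f i) ≤ ∏ i ∈ s, sp (f i) := by
  classical
  induction s using Finset.induction_on with
  | empty => simpa using sp_one
  | insert a s ha ih =>
    rw [Finset.prod_insert ha, Finset.prod_insert ha]
    exact (sp_mul _ _).trans (Nat.mul_le_mul_left _ ih)

lemma sp_pow (p : MvPolynomial τ F) (n : ℕ) : sp (p ^ n) ≤ sp p ^ n := by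
  induction n with
  | zero => simpa using sp_one
  | succ n ih =>
    rw [pow_succ, pow_succ]
    exact (sp_mul _ _).trans (Nat.mul_le_mul_right _ ih)

lemma sp_linear (φ : MvPolynomial τ F →ₗ[F] MvPolynomial τ F)
    (h : ∀ m a, sp (φ (monomial m a)) ≤ 1) (p : MvPolynomial τ F) : sp (φ p) ≤ sp p := by
  conv_lhs => rw [p.as_sum, map_sum]
  refine (sp_sum _ _).trans ?_
  refine (Finset.sum_le_sum (fun i _ => h _ _)).trans ?_
  simp [sp]

lemma sp_pderiv (v : τ) (p : MvPolynomial τ F) : sp (pderiv v p) ≤ sp p := by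
  apply sp_linear (pderiv v).toLinearMap
  intro m a
  change sp (pderiv v (monomial m a)) ≤ 1
  rw [pderiv_monomial]
  exact sp_monomial _ _

open Classical in
def sub (x0 : τ) (a : F) : MvPolynomial τ F →ₐ[F] MvPolynomial τ F :=
  bind₁ (fun v => if v = x0 then C a else X v)

lemma sp_sub (x0 : τ) (a : F) (p : MvPolynomial τ F) : sp (sub x0 a p) ≤ sp p := by
  classical
  apply sp_linear (sub x0 a).toLinearMap
  intro m b
  change sp (sub x0 a (monomial m b)) ≤ 1
  unfold sub
  rw [bind₁_monomial]
  refine (sp_mul _ _).trans ?_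
  refine (Nat.mul_le_mul (sp_C b) (?_ : _ ≤ 1)).trans (by simp)
  refine (sp_prod _ _).trans ?_
  apply Finset.prod_le_one' 
  intro i _
  refine (sp_pow _ _).trans ?_
  apply pow_le_one' 
  split_ifs
  · exact sp_C _
  · exact sp_X _

lemma sub_eq_self (x0 : τ) (a : F) (p : MvPolynomial τ F) (h : x0 ∉ p.vars) :
    sub x0 a p = p := by
  classical
  have : sub x0 a p = bind₁ X p := by
    unfold sub bind₁
    refine eval₂Hom_congr' rfl ?_ rfl
    intro i hi _
    rw [if_neg]
    rintro rfl
    exact h hi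
  rw [this]; simp

lemma vars_sub (x0 : τ) (a : F) (p : MvPolynomial τ F) : (sub x0 a p).vars ⊆ p.vars := by
  classical
  unfold sub
  refine (vars_bind₁ _ _).trans ?_
  intro x hx
  rw [Finset.mem_biUnion] at hx
  obtain ⟨i, hi, hx⟩ := hx
  split_ifs at hx
  · simp at hx
  · simp at hx; rwa [hx]

lemma pderiv_prod_pow {J : Type} [DecidableEq J] (v : τ) (Q : J → MvPolynomial τ F) (e : J → ℕ)
    (rel : Finset J) (he : ∀ j, 1 ≤ e j) :
    pderiv v (∏ j ∈ rel, Q j ^ e j) = (∏ j ∈ rel, Q j ^ (e j - 1)) *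
      ∑ j ∈ rel, C (e j : F) * pderiv v (Q j) * ∏ j' ∈ rel.erase j, Q j' := by
  induction rel using Finset.induction_on with
  | empty => simp
  | insert a s ha ih =>
    have hE : ∀ j, Q j ^ e j = Q j ^ (e j - 1) * Q j := by
      intro j; rw [← pow_succ]; congr 1; have := he j; omega
    have hP : ∏ j ∈ s, Q j ^ e j = (∏ j ∈ s, Q j ^ (e j - 1)) * ∏ j ∈ s, Q j := by
      rw [← Finset.prod_mul_distrib]; exact Finset.prod_congr rfl (fun j _ => hE j)
    rw [Finset.prod_insert ha, Finset.prod_insert ha, Finset.sum_insert ha, Derivation.leibniz, ih,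
      Derivation.leibniz_pow, Finset.erase_insert ha, hP]
    have : ∑ j ∈ s, C (e j : F) * pderiv v (Q j) * ∏ j' ∈ (insert a s).erase j, Q j' =
        Q a * ∑ j ∈ s, C (e j : F) * pderiv v (Q j) * ∏ j' ∈ s.erase j, Q j' := by
      rw [Finset.mul_sum]
      apply Finset.sum_congr rfl
      intro j hj
      have hja : a ≠ j := by rintro rfl; exact ha hj
      rw [Finset.erase_insert_of_ne hja, Finset.prod_insert (by simp [ha])]
      ring
    rw [this, hE a]
    simp only [smul_eq_mul, nsmul_eq_mul, map_natCast]
    ring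

lemma pderiv_prod_pow' {J : Type} [Fintype J] [DecidableEq J] (v : τ)
    (Q : J → MvPolynomial τ F) (e : J → ℕ)
    (rel : Finset J) (he : ∀ j, 1 ≤ e j) (h : ∀ j, j ∉ rel → pderiv v (Q j) = 0) :
    pderiv v (∏ j, Q j ^ e j) = ((∏ j ∈ relᶜ, Q j ^ e j) * (∏ j ∈ rel, Q j ^ (e j - 1))) *
      ∑ j ∈ rel, C (e j : F) * pderiv v (Q j) * ∏ j' ∈ rel.erase j, Q j' := by
  have h0 : pderiv v (∏ j ∈ relᶜ, Q j ^ e j) = 0 := by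
    rw [pderiv_prod_pow v Q e _ he, Finset.sum_eq_zero, mul_zero]
    intro j hj
    rw [h j (by simpa using hj)]; simp
  rw [← Finset.prod_mul_prod_compl rel, Derivation.leibniz, h0, pderiv_prod_pow v Q e _ he]
  simp only [smul_eq_mul]
  ring

lemma sp_det {ι κ : Type} [Fintype ι] (V : Matrix ι κ (MvPolynomial τ F)) (B : ι → ℕ)
    (hB1 : ∀ i, 1 ≤ B i) (hB : ∀ i l, sp (V i l) ≤ B i) (r : ℕ) (e : Fin r → ι) (f : Fin r → κ)
    (he : Function.Injective e) :
    sp (V.submatrix e f).det ≤ (Fintype.card ι).factorial * ∏ i, B i := by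
  classical
  have hr : r ≤ Fintype.card ι := by simpa using Fintype.card_le_of_injective e he
  have h1 : ∏ q, B (e q) ≤ ∏ i, B i := by
    rw [← Finset.prod_image (s := univ) (g := e) (f := B) (fun a _ b _ h => he h)]
    exact Finset.prod_le_prod_of_subset_of_one_le' (Finset.subset_univ _) (fun i _ _ => hB1 i)
  rw [Matrix.det_apply]
  refine (sp_sum _ _).trans ?_
  have h2 : ∀ σ ∈ (univ : Finset (Equiv.Perm (Fin r))),
      sp (Equiv.Perm.sign σ • ∏ i, V.submatrix e f (σ i) i) ≤ ∏ q, B (e q) := by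
    intro σ _
    have h3 : sp (∏ i, V.submatrix e f (σ i) i) ≤ ∏ q, B (e q) := by
      refine (sp_prod _ _).trans ?_
      rw [← Equiv.prod_comp σ (fun q => B (e q))]
      exact Finset.prod_le_prod' (fun i _ => hB _ _)
    rcases Int.units_eq_one_or (Equiv.Perm.sign σ) with h | h
    · rw [h, one_smul]; exact h3
    · rw [h, Units.neg_smul, one_smul, sp_neg]; exact h3
  refine (Finset.sum_le_card_nsmul _ _ _ h2).trans ?_
  rw [Finset.card_univ, Fintype.card_perm, Fintype.card_fin, smul_eq_mul]
  exact Nat.mul_le_mul (Nat.factorial_le hr) h1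

end sparse
end
end Occ

namespace Occ
open Finset
noncomputable section

lemma imm_side {α : Type} [Fintype α] [DecidableEq α] {F : Type} [Field F] (z r0 : α)
    (hzr : z ≠ r0) (χ : Equiv.Perm α → F) (l : α) :
    pderiv (z, l) (sub (r0, r0) 1 (∑ σ : Equiv.Perm α, C (χ σ) * ∏ i, X (i, σ i)) -
      sub (r0, r0) 0 (∑ σ : Equiv.Perm α, C (χ σ) * ∏ i, X (i, σ i)) : MvPolynomial (α × α) F) =
    ∑ σ ∈ TT z ((univ.erase r0).erase z) 1, if σ z = l then
      C (χ σ) * ∏ i ∈ (univ.erase r0).erase z, (X (i, σ i) : MvPolynomial (α × α) F) else 0 := by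
  have hT : TT z ((univ.erase r0).erase z) 1 = univ.filter (fun σ => σ r0 = r0) := by
    ext σ
    simp only [TT, mem_filter, mem_univ, true_and, mem_insert, mem_erase, Equiv.Perm.one_apply]
    constructor
    · intro h; exact h r0 (by simp [hzr.symm])
    · intro h i hi
      have : i = r0 := by tauto
      rw [this, h]
  rw [hT, Finset.sum_filter, map_sum, map_sum, ← Finset.sum_sub_distrib, map_sum]
  apply Finset.sum_congr rfl
  intro σ _
  have hs : ∀ a : F, sub (r0, r0) a (C (χ σ) * ∏ i, (X (i, σ i) : MvPolynomial (α × α) F)) =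
      C (χ σ) * ((if σ r0 = r0 then C a else X (r0, σ r0)) *
        ∏ i ∈ univ.erase r0, X (i, σ i)) := by
    intro a
    rw [← Finset.mul_prod_erase univ _ (mem_univ r0)]
    simp only [sub, map_mul, bind₁_C_right, bind₁_X_right, map_prod]
    congr 2
    · simp
    · apply Finset.prod_congr rfl
      intro i hi
      rw [mem_erase] at hi
      rw [if_neg]
      intro h
      exact hi.1 (congrArg Prod.fst h)
  rw [hs, hs]
  have hp0 : pderiv (z, l) (∏ i ∈ (univ.erase r0).erase z, (X (i, σ i) : MvPolynomial (α × α) F))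
      = 0 := by
    refine Finset.prod_induction _ (fun p => pderiv (z, l) p = 0) ?_ ?_ ?_
    · intro a b ha hb
      rw [Derivation.leibniz, ha, hb]; simp
    · simp
    · intro i hi
      rw [mem_erase] at hi
      rw [pderiv_X_of_ne]
      intro h
      exact hi.1 (congrArg Prod.fst h)
  by_cases h : σ r0 = r0
  · simp only [h, if_true, map_one, one_mul, map_zero, zero_mul, mul_zero, sub_zero]
    rw [← Finset.mul_prod_erase (univ.erase r0) _ (by simp [hzr] : z ∈ univ.erase r0),
      Derivation.leibniz, Derivation.leibniz, hp0, pderiv_C, pderiv_X]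
    by_cases hl : σ z = l
    · simp [hl]
    · have : (z, σ z) ≠ (z, l) := fun e => hl (congrArg Prod.snd e)
      simp [hl, this]
  · simp [h]

open Classical in
lemma core {n k : ℕ} (hk : 1 ≤ k) (hn : 2 * k + 2 ≤ n) {F : Type} [Field F]
    (χ : Equiv.Perm (Fin n) → F) (hχ : ∀ σ, χ σ ≠ 0) {m : ℕ} (d : Fin m → ℕ)
    (P : (i : Fin m) → Fin (d i) → MvPolynomial (Fin n × Fin n) F)
    (e : (i : Fin m) → Fin (d i) → ℕ) (he : ∀ i j, 1 ≤ e i j)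
    (heq : ∑ σ : Equiv.Perm (Fin n), C (χ σ) *
              ∏ i : Fin n, (X (i, σ i) : MvPolynomial (Fin n × Fin n) F) =
          ∑ i : Fin m, ∏ j : Fin (d i), P i j ^ e i j)
    (hocc : ∀ v : Fin n × Fin n,
          (Finset.univ.filter
            fun q : (i : Fin m) × Fin (d i) => v ∈ (P q.1 q.2).vars).card ≤ k)
    (s : ℕ) (hs2 : 2 ≤ s) (hs : ∀ i j, sp (P i j) ≤ s) :
    2 ^ n ≤ s ^ (26 * k ^ 2) := by
  let z : Fin n := ⟨0, by omega⟩
  let r0 : Fin n := ⟨n - 1, by omega⟩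
  have hzr : z ≠ r0 := by
    intro h
    have := congrArg Fin.val h
    simp only [z, r0] at this
    omega
  let x0 : Fin n × Fin n := (r0, r0)
  set R : Finset (Fin n) := (univ.erase r0).erase z with hR
  have hzR : z ∉ R := by simp [hR]
  have hCC : CC z R 1 = univ.erase r0 := by
    ext x
    simp only [CC, hR, mem_image, mem_insert, mem_erase, mem_univ, Equiv.Perm.one_apply]
    constructor
    · rintro ⟨i, hi, rfl⟩
      rcases hi with rfl | hi
      · simp [hzr]
      · exact ⟨hi.2.1, trivial⟩
    · intro h
      refine ⟨x, ?_, rfl⟩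
      by_cases hx : x = z
      · exact Or.inl hx
      · exact Or.inr ⟨hx, h.1, trivial⟩
  have hCard : (univ.erase r0).card = n - 1 := by simp
  obtain ⟨L0, hL0, hL0c⟩ := Finset.exists_subset_card_eq (s := univ.erase r0) (n := 2 * k + 1)
    (by rw [hCard]; omega)
  let I : Finset (Fin m) := univ.filter (fun i => ∃ j, x0 ∈ (P i j).vars)
  have hI : I.card ≤ k := by
    refine le_trans ?_ (hocc x0)
    refine le_trans (Finset.card_le_card ?_) (Finset.card_image_le (f := Sigma.fst))
    intro i hi
    simp only [I, mem_filter, mem_univ, true_and] at hi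
    obtain ⟨j, hj⟩ := hi
    rw [mem_image]
    exact ⟨⟨i, j⟩, by simpa using hj, rfl⟩
  let rel : (i : Fin m) → Finset (Fin (d i)) := fun i =>
    univ.filter (fun j => ∃ l ∈ L0, (z, l) ∈ (P i j).vars)
  have hrel : ∑ i, (rel i).card ≤ (2 * k + 1) * k := by
    rw [← Finset.card_sigma, ← hL0c]
    refine le_trans (Finset.card_le_card ?_) (Finset.card_biUnion_le_card_mul L0
      (fun l => Finset.univ.filter
            fun q : (i : Fin m) × Fin (d i) => (z, l) ∈ (P q.1 q.2).vars) k (fun l _ => hocc _))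
    rintro ⟨i, j⟩ hq
    simp only [rel, mem_sigma, mem_filter, mem_univ, true_and] at hq
    simp only [mem_biUnion, mem_filter, mem_univ, true_and]
    exact hq
  let val : Bool → F := fun b => if b then 1 else 0
  let sg : Bool → MvPolynomial (Fin n × Fin n) F := fun b => if b then 1 else -1
  let Q : (b : Bool) → (i : Fin m) → Fin (d i) → MvPolynomial (Fin n × Fin n) F :=
    fun b i j => sub x0 (val b) (P i j)
  have hQs : ∀ b i j, sp (Q b i j) ≤ s := fun b i j => (sp_sub _ _ _).trans (hs i j)
  let V : Matrix ({i // i ∈ I} × Bool) (Fin n) (MvPolynomial (Fin n × Fin n) F) := fun q l =>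
    ∑ j ∈ rel q.1.1, C (e q.1.1 j : F) * pderiv (z, l) (Q q.2 q.1.1 j) *
      ∏ j' ∈ (rel q.1.1).erase j, Q q.2 q.1.1 j'
  let H : ({i // i ∈ I} × Bool) → MvPolynomial (Fin n × Fin n) F := fun q =>
    (∏ j ∈ (rel q.1.1)ᶜ, Q q.2 q.1.1 j ^ e q.1.1 j) *
      (∏ j ∈ rel q.1.1, Q q.2 q.1.1 j ^ (e q.1.1 j - 1))
  have hι : Fintype.card ({i // i ∈ I} × Bool) ≤ 2 * k := by
    rw [Fintype.card_prod, Fintype.card_coe, Fintype.card_bool]; omega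
  obtain ⟨c, hc0, ⟨l1, hl1, hcl1⟩, hcV, hcd⟩ := kernel V L0 (by omega)
  -- the sparsity bound
  let B : ({i // i ∈ I} × Bool) → ℕ := fun q => s ^ (2 * (rel q.1.1).card)
  have hB1 : ∀ q, 1 ≤ B q := fun q => Nat.one_le_pow _ _ (by omega)
  have hVB : ∀ q l, sp (V q l) ≤ B q := by
    intro q l
    refine (sp_sum _ _).trans ?_
    have h1 : ∀ j ∈ rel q.1.1, sp (C (e q.1.1 j : F) * pderiv (z, l) (Q q.2 q.1.1 j) *
      ∏ j' ∈ (rel q.1.1).erase j, Q q.2 q.1.1 j') ≤ s ^ (rel q.1.1).card := by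
      intro j hj
      refine (sp_mul _ _).trans ?_
      have e1 : sp (C (e q.1.1 j : F) * pderiv (z, l) (Q q.2 q.1.1 j)) ≤ s := by
        refine (sp_mul _ _).trans ?_
        refine (Nat.mul_le_mul (sp_C _) ((sp_pderiv _ _).trans (hQs _ _ _))).trans (by simp)
      have e2 : sp (∏ j' ∈ (rel q.1.1).erase j, Q q.2 q.1.1 j') ≤ s ^ ((rel q.1.1).card - 1) := by
        refine (sp_prod _ _).trans ?_
        rw [← Finset.card_erase_of_mem hj, ← Finset.prod_const]
        exact Finset.prod_le_prod' (fun _ _ => hQs _ _ _)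
      refine (Nat.mul_le_mul e1 e2).trans ?_
      rw [← pow_succ']
      have : 0 < (rel q.1.1).card := Finset.card_pos.mpr ⟨j, hj⟩
      exact Nat.pow_le_pow_right (by omega) (by omega)
    refine (Finset.sum_le_card_nsmul _ _ _ h1).trans ?_
    simp only [smul_eq_mul, B]
    rw [two_mul, pow_add]
    apply Nat.mul_le_mul_right
    exact (Nat.lt_two_pow_self).le.trans (Nat.pow_le_pow_left hs2 _)
  have hBp : ∏ q, B q ≤ s ^ (4 * ((2 * k + 1) * k)) := by
    simp only [B]
    rw [Finset.prod_pow_eq_pow_sum]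
    apply Nat.pow_le_pow_right (by omega)
    rw [Fintype.sum_prod_type]
    simp only [Finset.sum_const, card_univ, Fintype.card_bool, smul_eq_mul]
    have : ∑ i : {i // i ∈ I}, 2 * (2 * (rel i.1).card) = ∑ i ∈ I, 2 * (2 * (rel i).card) :=
      Finset.sum_coe_sort I (fun i => 2 * (2 * (rel i).card))
    rw [this, ← Finset.mul_sum, ← Finset.mul_sum]
    have := Finset.sum_le_sum_of_subset (f := fun i => (rel i).card) (Finset.subset_univ I)
    omega
  have hcs : ∀ l, sp (c l) ≤ (2 * k).factorial * s ^ (4 * ((2 * k + 1) * k)) := by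
    intro l
    rcases hcd l with h | ⟨r, e', f', hinj, h⟩
    · rw [h, sp_zero]; exact Nat.zero_le _
    · have := sp_det V B hB1 hVB r e' f' hinj
      refine le_trans ?_ (this.trans (Nat.mul_le_mul (Nat.factorial_le hι) hBp))
      rcases h with h | h
      · rw [h]
      · rw [h, sp_neg]
  -- the relation
  set G : MvPolynomial (Fin n × Fin n) F :=
    sub x0 1 (∑ σ : Equiv.Perm (Fin n), C (χ σ) * ∏ i, X (i, σ i)) -
      sub x0 0 (∑ σ : Equiv.Perm (Fin n), C (χ σ) * ∏ i, X (i, σ i)) with hG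
  have hG2 : G = ∑ q : {i // i ∈ I} × Bool, sg q.2 * ∏ j, Q q.2 q.1.1 j ^ e q.1.1 j := by
    rw [hG, heq, map_sum, map_sum, ← Finset.sum_sub_distrib, Fintype.sum_prod_type]
    have h1 : ∀ i, i ∉ I → sub x0 1 (∏ j, P i j ^ e i j) - sub x0 0 (∏ j, P i j ^ e i j) = 0 := by
      intro i hi
      simp only [I, mem_filter, mem_univ, true_and, not_exists] at hi
      simp only [map_prod, map_pow]
      rw [sub_eq_zero]
      apply Finset.prod_congr rfl
      intro j _
      rw [sub_eq_self _ _ _ (hi j), sub_eq_self _ _ _ (hi j)]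
    rw [← Finset.sum_subset (Finset.subset_univ I) (fun i _ hi => h1 i hi), ← Finset.sum_coe_sort I]
    apply Finset.sum_congr rfl
    intro i _
    simp only [Fintype.sum_bool, sg, Q, val, map_prod, map_pow, if_true, Bool.false_eq_true, if_false]
    ring
  have hGl : ∀ l ∈ L0, pderiv (z, l) G = ∑ q, sg q.2 * H q * V q l := by
    intro l hl
    rw [hG2, map_sum]
    apply Finset.sum_congr rfl
    intro q _
    have hsg : pderiv (z, l) (sg q.2) = 0 := by
      simp only [sg]; split_ifs <;> simp
    rw [Derivation.leibniz, hsg, pderiv_prod_pow' (z, l) (Q q.2 q.1.1) (e q.1.1) (rel q.1.1)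
      (he _)]
    · simp only [smul_eq_mul, H, V]; ring
    · intro j hj
      apply pderiv_eq_zero_of_notMem_vars
      intro hv
      apply hj
      simp only [rel, mem_filter, mem_univ, true_and]
      exact ⟨l, hl, vars_sub _ _ _ hv⟩
  have hR0 : ∑ l, c l * pderiv (z, l) G = 0 := by
    have h1 : ∀ l, c l * pderiv (z, l) G = ∑ q, sg q.2 * H q * (V q l * c l) := by
      intro l
      by_cases hl : l ∈ L0
      · rw [hGl l hl, Finset.mul_sum]
        apply Finset.sum_congr rfl
        intro q _; ring
      · simp [hc0 l hl]
    simp only [h1]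
    rw [Finset.sum_comm]
    apply Finset.sum_eq_zero
    intro q _
    rw [← Finset.mul_sum, hcV, mul_zero]
  have hRel : Rel z R 1 χ c := by
    unfold Rel
    rw [← hR0]
    have h1 : ∀ l, pderiv (z, l) G = _ := fun l => imm_side z r0 hzr χ l
    simp only [h1, Finset.mul_sum]
    rw [Finset.sum_comm]
    apply Finset.sum_congr rfl
    intro σ _
    rw [Finset.sum_eq_single (σ z)]
    · rw [if_pos rfl]; ring
    · intro b _ hb; rw [if_neg hb.symm, mul_zero]
    · simp
  have main := main_lower z χ hχ _ R 1 c rfl hzR ⟨l1, by rw [hCC]; exact hL0 hl1, hcl1⟩ hRel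
  rw [hCC, hCard] at main
  have hLle : ((univ.erase r0).filter (fun l => c l ≠ 0)).card ≤ 2 * k + 1 := by
    rw [← hL0c]
    apply Finset.card_le_card
    intro l hl
    rw [mem_filter] at hl
    by_contra h
    exact hl.2 (hc0 l h)
  have hSle : ∑ l ∈ univ.erase r0, (c l).support.card ≤
      (2 * k + 1) * ((2 * k).factorial * s ^ (4 * ((2 * k + 1) * k))) := by
    rw [← Finset.sum_subset hL0 (fun l _ hl => by rw [hc0 l hl]; simp), ← smul_eq_mul]
    have := Finset.sum_le_card_nsmul L0 (fun l => (c l).support.card) _ (fun l _ => hcs l)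
    rwa [hL0c] at this
  have hfac : (2 * k + 1) * (2 * k).factorial ≤ s ^ ((2 * k + 1) * (2 * k + 1)) := by
    rw [← Nat.factorial_succ, pow_mul]
    refine (Nat.factorial_le_pow _).trans (Nat.pow_le_pow_left ?_ _)
    exact (Nat.lt_two_pow_self).le.trans (Nat.pow_le_pow_left hs2 _)
  have hp2 : ∀ t, 2 ^ t ≤ s ^ t := fun t => Nat.pow_le_pow_left hs2 t
  calc 2 ^ n = 2 * 2 ^ (n - 1) := by rw [← pow_succ']; congr 1; omega
    _ ≤ 2 * (((2 * k + 1) * ((2 * k).factorial * s ^ (4 * ((2 * k + 1) * k)))) *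
        2 ^ (2 * k + 1 + 1)) := by
      apply Nat.mul_le_mul_left
      refine main.trans (Nat.mul_le_mul hSle (Nat.pow_le_pow_right (by norm_num) (by omega)))
    _ = ((2 * k + 1) * (2 * k).factorial) * s ^ (4 * ((2 * k + 1) * k)) * 2 ^ (2 * k + 3) := by ring
    _ ≤ s ^ ((2 * k + 1) * (2 * k + 1)) * s ^ (4 * ((2 * k + 1) * k)) * s ^ (2 * k + 3) :=
      Nat.mul_le_mul (Nat.mul_le_mul_right _ hfac) (hp2 _)
    _ = s ^ ((2 * k + 1) * (2 * k + 1) + 4 * ((2 * k + 1) * k) + (2 * k + 3)) := by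
      rw [← pow_add, ← pow_add]
    _ ≤ s ^ (26 * k ^ 2) := Nat.pow_le_pow_right (by omega) (by nlinarith)

end
end Occ

theorem statement14 :
    ∃ c : ℝ, 0 < c ∧
      ∀ (n k : ℕ), 1 ≤ n → 1 ≤ k →
      ∀ (F : Type) [Field F] [CharZero F],
      ∀ (χ : Equiv.Perm (Fin n) →* Fˣ) (m : ℕ) (d : Fin m → ℕ)
        (P : (i : Fin m) → Fin (d i) → MvPolynomial (Fin n × Fin n) F)
        (e : (i : Fin m) → Fin (d i) → ℕ),
        (∀ i j, 1 ≤ e i j) →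
        (∑ σ : Equiv.Perm (Fin n),
            MvPolynomial.C ((χ σ : Fˣ) : F) *
              ∏ i : Fin n, (X (i, σ i) : MvPolynomial (Fin n × Fin n) F) =
          ∑ i : Fin m, ∏ j : Fin (d i), P i j ^ e i j) →
        (∀ v : Fin n × Fin n,
          (Finset.univ.filter
            fun q : (i : Fin m) × Fin (d i) => v ∈ (P q.1 q.2).vars).card ≤ k) →
        (2 : ℝ) ^ (c * n / k ^ 2) ≤
          ((m + ∑ i : Fin m, ∑ j : Fin (d i), (P i j).support.card : ℕ) : ℝ) := by
  classical
  refine ⟨1 / 26, by norm_num, ?_⟩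
  intro n k hn hk F _ _ χ m d P e he heq hocc
  set s : ℕ := m + ∑ i : Fin m, ∑ j : Fin (d i), (P i j).support.card with hs
  have hev1 := congrArg (MvPolynomial.eval (fun v : Fin n × Fin n => if v.1 = v.2 then (1 : F) else 0)) heq
  have hev0 := congrArg (MvPolynomial.eval (fun _ : Fin n × Fin n => (0 : F))) heq
  simp only [map_sum, map_mul, map_prod, eval_C, eval_X] at hev1 hev0
  rw [Finset.sum_eq_single 1] at hev1
  rotate_left
  · intro σ _ hσ
    obtain ⟨i, hi⟩ : ∃ i, σ i ≠ i := by
      by_contra h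
      push Not at h
      exact hσ (Equiv.ext h)
    rw [Finset.prod_eq_zero (Finset.mem_univ i) (if_neg (Ne.symm hi)), mul_zero]
  · simp
  rw [Finset.sum_eq_zero] at hev0
  rotate_left
  · intro σ _
    rw [Finset.prod_eq_zero (Finset.mem_univ (⟨0, by omega⟩ : Fin n)) rfl, mul_zero]
  simp only [map_one, Units.val_one, Equiv.Perm.one_apply, if_true, Finset.prod_const_one,
    mul_one] at hev1
  have hs2 : 2 ≤ s := by
    by_contra hlt
    have hm : m ≠ 0 := by
      rintro rfl
      simp at hev1
    have hm1 : m = 1 := by omega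
    subst hm1
    have hz : ∑ i : Fin 1, ∑ j : Fin (d i), (P i j).support.card = 0 := by omega
    have hP : ∀ i j, P i j = 0 := by
      intro i j
      rw [Finset.sum_eq_zero_iff] at hz
      have h1 := hz i (Finset.mem_univ i)
      rw [Finset.sum_eq_zero_iff] at h1
      have h2 := h1 j (Finset.mem_univ j)
      rwa [Finset.card_eq_zero, support_eq_empty] at h2
    simp only [Fin.sum_univ_one] at hev1 hev0
    by_cases hd : d 0 = 0
    · have : IsEmpty (Fin (d 0)) := by rw [hd]; infer_instance
      simp at hev0
    · have j0 : Fin (d 0) := ⟨0, by omega⟩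
      rw [Finset.prod_eq_zero (Finset.mem_univ j0)] at hev1
      · exact one_ne_zero hev1
      · rw [hP, map_pow, map_zero, zero_pow]
        have := he 0 j0
        omega
  have hsp : ∀ i j, Occ.sp (P i j) ≤ s := by
    intro i j
    have h1 := Finset.single_le_sum (f := fun j => (P i j).support.card)
      (fun _ _ => Nat.zero_le _) (Finset.mem_univ j)
    have h2 := Finset.single_le_sum (f := fun i => ∑ j : Fin (d i), (P i j).support.card)
      (fun _ _ => Nat.zero_le _) (Finset.mem_univ i)
    unfold Occ.sp
    omega
  have key : 2 ^ n ≤ s ^ (26 * k ^ 2) := by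
    by_cases hnk : 2 * k + 2 ≤ n
    · exact Occ.core hk hnk (fun σ => ((χ σ : Fˣ) : F)) (fun σ => (χ σ).ne_zero) d P e he heq
        (fun v => by convert hocc v) s hs2 hsp
    · calc 2 ^ n ≤ s ^ n := Nat.pow_le_pow_left hs2 n
        _ ≤ _ := Nat.pow_le_pow_right (by omega) (by nlinarith)
  have hk0 : (0 : ℝ) < 26 * (k : ℝ) ^ 2 := by
    have : (0 : ℝ) < k := by exact_mod_cast hk
    positivity
  have keyR : (2 : ℝ) ^ (n : ℝ) ≤ (s : ℝ) ^ (26 * (k : ℝ) ^ 2) := by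
    have : ((2 ^ n : ℕ) : ℝ) ≤ ((s ^ (26 * k ^ 2) : ℕ) : ℝ) := by exact_mod_cast key
    push_cast at this
    rw [Real.rpow_natCast]
    refine this.trans (le_of_eq ?_)
    rw [← Real.rpow_natCast]
    push_cast
    rfl
  have h3 := Real.rpow_le_rpow (Real.rpow_nonneg (by norm_num) _) keyR (le_of_lt (inv_pos.mpr hk0))
  rw [← Real.rpow_mul (by norm_num), ← Real.rpow_mul (Nat.cast_nonneg s),
    mul_inv_cancel₀ hk0.ne', Real.rpow_one] at h3
  refine le_trans (le_of_eq ?_) h3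
  congr 1
  field_simp
end

section
/- Let F be a field, let H_1, …, H_m ∈ F[x_1, …, x_n], let e_1, …, e_m be natural numbers, and set G = ∏_{j=1}^{m} H_j^{e_j}. Let S_1, …, S_w be finite multisets of the variables, and suppose that every variable x occurs in at most k of the polynomials H_1, …, H_m (i.e., at most k indices j are such that x appears in H_j). Then there exists a subset T ⊆ {1, …, m} with |T| ≤ k · |var(S_1) ∪ … ∪ var(S_w)| such that, setting G' = ∏_{j ∈ T} H_j^{e_j} and V = ∏_{j ∉ T} H_j^{e_j}, one has Δ_{S_i} G = V · Δ_{S_i} G' for every i ∈ {1, …, w}. -/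
open MvPolynomial

/-- `multiDeriv S f` : the iterated formal partial derivative of `f` with respect to the
variables of the multiset `S`, taken with multiplicity. -/
noncomputable def multiDeriv {F : Type*} [CommSemiring F] {n : ℕ} (S : Multiset (Fin n))
    (f : MvPolynomial (Fin n) F) : MvPolynomial (Fin n) F :=
  (S.sort (· ≤ ·)).foldr (fun x g => pderiv x g) f

theorem foldr_pderiv_mul_aux {F : Type*} [Field F] {n : ℕ} (V g : MvPolynomial (Fin n) F)
    (l : List (Fin n)) (h : ∀ x ∈ l, pderiv x V = 0) :
    l.foldr (fun x g => pderiv x g) (V * g) = V * l.foldr (fun x g => pderiv x g) g := by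
  induction l with
  | nil => rfl
  | cons a l ih =>
    have ih' := ih (fun x hx => h x (List.mem_cons_of_mem _ hx))
    have ha := h a List.mem_cons_self
    simp only [List.foldr_cons]
    rw [ih', pderiv_mul, ha]
    simp

theorem pderiv_prod_aux {F : Type*} [Field F] {n m : ℕ}
    (H : Fin m → MvPolynomial (Fin n) F) (e : Fin m → ℕ) (x : Fin n) (U : Finset (Fin m))
    (h : ∀ j ∈ U, x ∉ (H j).vars) : pderiv x (∏ j ∈ U, H j ^ e j) = 0 := by
  induction U using Finset.induction_on with
  | empty => simp
  | insert a U ha ih =>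
    have ih' := ih (fun j hj => h j (Finset.mem_insert_of_mem hj))
    have h1 := pderiv_eq_zero_of_notMem_vars (h a (Finset.mem_insert_self _ _))
    rw [Finset.prod_insert ha, pderiv_mul, ih', pderiv_pow, h1]
    simp

theorem statement16 {F : Type*} [Field F] {n m k w : ℕ}
    (H : Fin m → MvPolynomial (Fin n) F) (e : Fin m → ℕ)
    (S : Fin w → Multiset (Fin n))
    (hocc : ∀ x : Fin n, (Finset.univ.filter fun j => x ∈ (H j).vars).card ≤ k) :
    ∃ T : Finset (Fin m),
      T.card ≤ k * (Finset.univ.biUnion fun i : Fin w => (S i).toFinset).card ∧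
      ∀ i : Fin w,
        multiDeriv (S i) (∏ j : Fin m, H j ^ e j) =
          (∏ j ∈ Finset.univ \ T, H j ^ e j) *
            multiDeriv (S i) (∏ j ∈ T, H j ^ e j) := by
  refine ⟨(Finset.univ.biUnion fun i : Fin w => (S i).toFinset).biUnion
    (fun x => Finset.univ.filter fun j => x ∈ (H j).vars), ?_, ?_⟩
  · rw [mul_comm]
    exact Finset.card_biUnion_le_card_mul _ _ _ (fun x _ => hocc x)
  · intro i
    rw [← Finset.prod_sdiff (Finset.subset_univ ((Finset.univ.biUnion
      fun i : Fin w => (S i).toFinset).biUnion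
      (fun x => Finset.univ.filter fun j => x ∈ (H j).vars)))]
    unfold multiDeriv
    apply foldr_pderiv_mul_aux
    intro x hx
    rw [Multiset.mem_sort] at hx
    apply pderiv_prod_aux
    intro j hj hxj
    refine (Finset.mem_sdiff.1 hj).2 ?_
    simp only [Finset.mem_biUnion, Finset.mem_filter, Finset.mem_univ, true_and,
      Multiset.mem_toFinset]
    exact ⟨x, ⟨i, hx⟩, hxj⟩
end
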